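/- The even hyperbolic lattice U ⊕ D₄ ⊕ D₄ ⊕ D₄ ⊕ A₁ (the 2-elementary lattice with invariants (r,a,δ) = (15,7,1)) is reflective: the subgroup W_r of O(S) generated by reflections in all roots has finite index in O(S). -/

import Mathlib

open Matrix

/-- The bilinear form on `ℤⁿ` associated to a Gram matrix `G`. -/
def bform {n : ℕ} (G : Matrix (Fin n) (Fin n) ℤ) (x y : Fin n → ℤ) : ℤ :=
  x ⬝ᵥ G.mulVec y

/-- The orthogonal group `O(S)` of the lattice with Gram matrix `G`:
all `ℤ`-module automorphisms preserving the bilinear form. -/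
def OrthGroup (n : ℕ) (G : Matrix (Fin n) (Fin n) ℤ) :
    Subgroup ((Fin n → ℤ) ≃ₗ[ℤ] (Fin n → ℤ)) where
  carrier := {f | ∀ x y, bform G (f x) (f y) = bform G x y}
  one_mem' := fun _ _ => rfl
  mul_mem' := by
    intro f g hf hg x y
    exact (hf (g x) (g y)).trans (hg x y)
  inv_mem' := by
    intro f hf x y
    have h := (hf (f⁻¹ x) (f⁻¹ y)).symm
    rwa [show f (f⁻¹ x) = x from f.apply_symm_apply x,
      show f (f⁻¹ y) = y from f.apply_symm_apply y] at h

/-- A root: a vector of square `-2`, or of square `-4` whose pairing with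
the whole lattice is even. -/
def IsRoot {n : ℕ} (G : Matrix (Fin n) (Fin n) ℤ) (α : Fin n → ℤ) : Prop :=
  bform G α α = -2 ∨ (bform G α α = -4 ∧ ∀ x : Fin n → ℤ, (2 : ℤ) ∣ bform G α x)

/-- `f` is the reflection in a root `α`. -/
def IsReflection {n : ℕ} (G : Matrix (Fin n) (Fin n) ℤ)
    (f : (Fin n → ℤ) ≃ₗ[ℤ] (Fin n → ℤ)) : Prop :=
  ∃ α : Fin n → ℤ, IsRoot G α ∧
    ∀ x : Fin n → ℤ, f x = x - ((2 * bform G x α) / bform G α α) • α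

/-- The subgroup `W_r` of `O(S)` generated by the reflections in all roots. -/
def Wr (n : ℕ) (G : Matrix (Fin n) (Fin n) ℤ) : Subgroup ↥(OrthGroup n G) :=
  Subgroup.closure {f | IsReflection G f.val}

open Matrix

/-- Orthogonal direct sum of two Gram matrices. -/
def dsum {m k : ℕ} (A : Matrix (Fin m) (Fin m) ℤ) (B : Matrix (Fin k) (Fin k) ℤ) :
    Matrix (Fin (m + k)) (Fin (m + k)) ℤ :=
  Matrix.reindex finSumFinEquiv finSumFinEquiv (Matrix.fromBlocks A 0 0 B)

/-- Gram matrix of the hyperbolic plane `U`. -/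
def gramU : Matrix (Fin 2) (Fin 2) ℤ := !![0, 1; 1, 0]

/-- Gram matrix of `A₁ = ⟨-2⟩`. -/
def gramA1 : Matrix (Fin 1) (Fin 1) ℤ := !![-2]

/-- Gram matrix (= negative Cartan matrix) of a simply laced root lattice with
given Dynkin diagram edges. -/
def adjGram (n : ℕ) (E : List (ℕ × ℕ)) : Matrix (Fin n) (Fin n) ℤ :=
  Matrix.of fun i j =>
    if i = j then -2 else if (i.1, j.1) ∈ E ∨ (j.1, i.1) ∈ E then 1 else 0

/-- Gram matrix of the negative definite root lattice `Dₙ`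
(in the root basis `e₁+e₂, e₂-e₁, e₃-e₂, …, eₙ-eₙ₋₁` of `{x ∈ ℤⁿ : Σxᵢ even}`
with the negative of the standard Euclidean form). -/
def gramD (n : ℕ) : Matrix (Fin n) (Fin n) ℤ :=
  adjGram n ((0, 2) :: (List.range (n - 2)).map fun k => (k + 1, k + 2))

/-- Gram matrix (negative Cartan matrix) of `E₈`. -/
def gramE8 : Matrix (Fin 8) (Fin 8) ℤ :=
  adjGram 8 [(0, 2), (1, 3), (2, 3), (3, 4), (4, 5), (5, 6), (6, 7)]

/-- Gram matrix (negative Cartan matrix) of `E₇`. -/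
def gramE7 : Matrix (Fin 7) (Fin 7) ℤ :=
  adjGram 7 [(0, 2), (1, 3), (2, 3), (3, 4), (4, 5), (5, 6)]

/-- The Gram matrix of the even 2-elementary hyperbolic lattice `U ⊕ D₄ ⊕ D₄ ⊕ D₄ ⊕ A₁`,
with invariants `(r,a,δ) = (15,7,1)`. -/
def gramS :=
  dsum gramU (dsum (gramD 4) (dsum (gramD 4) (dsum (gramD 4) gramA1)))

section BilinearForm

variable {n : ℕ} {G : Matrix (Fin n) (Fin n) ℤ}

lemma bform_add_left (x y z : Fin n → ℤ) : bform G (x + y) z = bform G x z + bform G y z := by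
  simp [bform, add_dotProduct]

lemma bform_sub_left (x y z : Fin n → ℤ) : bform G (x - y) z = bform G x z - bform G y z := by
  simp [bform, sub_dotProduct]

lemma bform_neg_left (x z : Fin n → ℤ) : bform G (-x) z = -bform G x z := by
  simp [bform, neg_dotProduct]

lemma bform_smul_left (c : ℤ) (x z : Fin n → ℤ) : bform G (c • x) z = c * bform G x z := by
  rw [bform, smul_dotProduct]; rfl

lemma bform_comm (hG : G.IsSymm) (x y : Fin n → ℤ) : bform G x y = bform G y x := by
  rw [bform, bform, dotProduct_mulVec, dotProduct_comm, ← mulVec_transpose, hG.eq]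

lemma bform_sub_right (x y z : Fin n → ℤ) : bform G x (y - z) = bform G x y - bform G x z := by
  simp [bform, mulVec_sub, dotProduct_sub]

lemma bform_add_right (x y z : Fin n → ℤ) : bform G x (y + z) = bform G x y + bform G x z := by
  simp [bform, mulVec_add, dotProduct_add]

lemma bform_neg_right (x z : Fin n → ℤ) : bform G x (-z) = -bform G x z := by
  simp [bform, mulVec_neg]

lemma bform_smul_right (c : ℤ) (x z : Fin n → ℤ) : bform G x (c • z) = c * bform G x z := by
  rw [bform, mulVec_smul, dotProduct_smul]; rfl

lemma IsRoot.norm_neg {α : Fin n → ℤ} (hα : IsRoot G α) : bform G α α < 0 := by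
  rcases hα with h | ⟨h, -⟩ <;> omega

lemma IsRoot.coeff_mul_norm (hG : G.IsSymm) {α : Fin n → ℤ} (hα : IsRoot G α) (x : Fin n → ℤ) :
    (2 * bform G x α) / bform G α α * bform G α α = 2 * bform G x α := by
  refine Int.ediv_mul_cancel ?_
  rcases hα with h | ⟨h, h2⟩
  · rw [h]; exact ⟨-bform G x α, by ring⟩
  · obtain ⟨c, hc⟩ := h2 x
    rw [h, bform_comm hG, hc]; exact ⟨-c, by ring⟩

/-- For every root `α` the group `W_r` contains the reflection in `α`. -/
lemma exists_reflection (hG : G.IsSymm) {α : Fin n → ℤ} (hα : IsRoot G α) :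
    ∃ s ∈ Wr n G, ∀ x, s.val x = x - ((2 * bform G x α) / bform G α α) • α := by
  have hN := hα.norm_neg.ne
  have hc := hα.coeff_mul_norm hG
  let f : (Fin n → ℤ) →ₗ[ℤ] ℤ :=
    { toFun := fun x => (2 * bform G x α) / bform G α α
      map_add' := fun x y => by
        refine mul_right_cancel₀ hN ?_
        rw [add_mul, hc, hc, hc, bform_add_left]; ring
      map_smul' := fun c x => by
        refine mul_right_cancel₀ hN ?_
        rw [hc, bform_smul_left, smul_eq_mul, mul_assoc, RingHom.id_apply, hc]; ring }
  have hf : ∀ x, f x * bform G α α = 2 * bform G x α := hc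
  have hfα : f α = 2 := mul_right_cancel₀ hN (hf α)
  have hs : Module.reflection hfα ∈ OrthGroup n G := by
    intro x y
    have h1 := hf x
    have h2 := hf y
    simp only [Module.reflection_apply, bform_sub_left, bform_sub_right, bform_smul_left,
      bform_smul_right]
    rw [bform_comm hG α y]
    refine mul_left_cancel₀ (two_ne_zero (α := ℤ)) ?_
    linear_combination f y * h1 + f x * h2
  refine ⟨⟨Module.reflection hfα, hs⟩, Subgroup.subset_closure ⟨α, hα, fun x => ?_⟩, fun x => ?_⟩
  · exact Module.reflection_apply x hfα
  · exact Module.reflection_apply x hfα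

/-- Two vectors in the same nappe of the light cone, one of them timelike, pair positively. -/
lemma bform_pos_of_same_nappe (hG : G.IsSymm) {h : Fin n → ℤ}
    (hneg : ∀ x, bform G x h = 0 → bform G x x ≤ 0) {z u : Fin n → ℤ}
    (hz : 0 < bform G z z) (hu : 0 ≤ bform G u u) (hzh : 0 < bform G z h)
    (huh : 0 < bform G u h) : 0 < bform G z u := by
  by_contra! hzu
  have hw := hneg (bform G u h • z - bform G z h • u) (by
    simp only [bform_sub_left, bform_smul_left]; ring)
  simp only [bform_sub_left, bform_smul_left, bform_sub_right, bform_smul_right,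
    bform_comm hG u z] at hw
  have h1 := mul_pos (mul_pos huh huh) hz
  have h2 := mul_nonneg (mul_nonneg hzh.le hzh.le) hu
  have h3 := mul_nonneg (mul_nonneg hzh.le huh.le) (neg_nonneg.2 hzu)
  linarith

variable {ι : Type*} {α : ι → Fin n → ℤ} {h : Fin n → ℤ}

/-- Descent: every timelike vector in the nappe of `h` is moved by `W_r` into the cone
cut out by the given roots. -/
lemma exists_mem_Wr_nonneg (hG : G.IsSymm) (hα : ∀ i, IsRoot G (α i))
    (hαh : ∀ i, 0 < bform G (α i) h) (hneg : ∀ x, bform G x h = 0 → bform G x x ≤ 0)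
    (v : Fin n → ℤ) (hv : 0 < bform G v v) (hvh : 0 < bform G v h) :
    ∃ w ∈ Wr n G, ∀ i, 0 ≤ bform G (w.val v) (α i) := by
  induction hk : (bform G v h).toNat using Nat.strong_induction_on generalizing v with
  | _ k ih =>
    by_cases hP : ∀ i, 0 ≤ bform G v (α i)
    · exact ⟨1, one_mem _, hP⟩
    push Not at hP
    obtain ⟨i, hi⟩ := hP
    obtain ⟨s, hsW, hs⟩ := exists_reflection hG (hα i)
    have hc := (hα i).coeff_mul_norm hG v
    have hN := (hα i).norm_neg
    have hsv := hs v
    set c := (2 * bform G v (α i)) / bform G (α i) (α i)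
    have hcpos : 0 < c := by
      by_contra! hc0
      nlinarith
    have hnorm : bform G (s.val v) (s.val v) = bform G v v := s.2 v v
    have hvs : 0 < bform G v (s.val v) := by
      rw [hsv, bform_sub_right, bform_smul_right]
      nlinarith
    have hsh : bform G (s.val v) h = bform G v h - c * bform G (α i) h := by
      rw [hsv, bform_sub_left, bform_smul_left]
    have hlt : bform G (s.val v) h < bform G v h := by
      rw [hsh]; nlinarith [mul_pos hcpos (hαh i)]
    have hpos : 0 < bform G (s.val v) h := by
      by_contra! hle
      rcases hle.lt_or_eq with hlt' | heq
      · have := bform_pos_of_same_nappe hG hneg (z := v) (u := -s.val v) hv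
          (by rw [bform_neg_left, bform_neg_right, neg_neg, hnorm]; exact hv.le) hvh
          (by rw [bform_neg_left]; linarith)
        rw [bform_neg_right] at this
        linarith
      · have := hneg _ heq
        omega
    obtain ⟨w, hw, hwP⟩ := ih _ (by omega) (s.val v) (hnorm ▸ hv) hpos rfl
    exact ⟨w * s, mul_mem hw hsW, hwP⟩

/-- Dickson's lemma: a cone meeting only the closed positive cone contains finitely many
lattice vectors of given positive norm. -/
lemma finite_nonneg_norm_eq [Finite ι] (hG : G.IsSymm)
    (hneg : ∀ x, bform G x h = 0 → bform G x x ≤ 0)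
    (hP : ∀ u, u ≠ 0 → (∀ i, 0 ≤ bform G u (α i)) → 0 ≤ bform G u u ∧ 0 < bform G u h)
    {m : ℤ} (hm : 0 < m) :
    {v | (∀ i, 0 ≤ bform G v (α i)) ∧ bform G v v = m}.Finite := by
  set F := {v | (∀ i, 0 ≤ bform G v (α i)) ∧ bform G v v = m}
  let φ : (Fin n → ℤ) → ι → ℕ := fun v i => (bform G v (α i)).toNat
  have key : ∀ v ∈ F, ∀ v' ∈ F, φ v ≤ φ v' → v = v' := by
    intro v hv v' hv' hle
    by_contra hne
    obtain ⟨hu, huh⟩ := hP (v' - v) (sub_ne_zero.2 (Ne.symm hne)) fun i => by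
      have h1 : (bform G v (α i)).toNat ≤ (bform G v' (α i)).toNat := hle i
      have h2 := hv.1 i
      have h3 := hv'.1 i
      rw [bform_sub_left]
      omega
    have hv0 : v ≠ 0 := by
      rintro rfl
      have : bform G 0 0 = m := hv.2
      simp [bform] at this
      omega
    have hvh := (hP v hv0 hv.1).2
    have hvu := bform_pos_of_same_nappe hG hneg (hv.2 ▸ hm) hu hvh huh
    have e1 := hv.2
    have e2 := hv'.2
    simp only [bform_sub_left, bform_sub_right, bform_comm hG v' v] at hu hvu
    linarith
  refine Set.Finite.of_finite_image (f := φ) ?_ fun v hv v' hv' hvv' => key v hv v' hv' hvv'.le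
  have hanti : IsAntichain (· ≤ ·) (φ '' F) := by
    rintro _ ⟨v, hv, rfl⟩ _ ⟨v', hv', rfl⟩ hne hle
    exact hne (congrArg φ (key v hv v' hv' hle))
  exact hanti.finite_of_wellQuasiOrdered wellQuasiOrdered_le

/-- A hyperbolic lattice is reflective as soon as finitely many roots cut out a polyhedral
cone contained in the closed positive cone. -/
theorem finiteIndex_Wr_of_cone [Finite ι] (hG : G.IsSymm) (hα : ∀ i, IsRoot G (α i))
    (hαh : ∀ i, 0 < bform G (α i) h) (hh : 0 < bform G h h)
    (hneg : ∀ x, bform G x h = 0 → bform G x x ≤ 0)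
    (hfin : ∀ a b, {x | bform G x h = a ∧ bform G x x = b}.Finite)
    (hP : ∀ u, u ≠ 0 → (∀ i, 0 ≤ bform G u (α i)) → 0 ≤ bform G u u ∧ 0 < bform G u h) :
    (Wr n G).FiniteIndex := by
  have hstab : {g : OrthGroup n G | g.val h = h}.Finite := by
    refine Set.Finite.of_finite_image
      (f := fun g : OrthGroup n G => fun i => g.val (Pi.single i 1)) ?_ ?_
    · refine (Set.Finite.pi' fun i : Fin n => hfin (bform G (Pi.single i 1) h)
        (bform G (Pi.single i 1) (Pi.single i 1))).subset ?_
      rintro _ ⟨g, hg, rfl⟩ i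
      refine ⟨?_, g.2 _ _⟩
      have := g.2 (Pi.single i 1) h
      rwa [show g.val h = h from hg] at this
    · intro g _ g' _ hgg'
      refine Subtype.ext (LinearEquiv.toLinearMap_injective ?_)
      exact LinearMap.pi_ext' fun i => LinearMap.ext_ring (congrFun hgg' i)
  have hfib : ∀ v, {g : OrthGroup n G | g.val h = v}.Finite := by
    intro v
    rcases Set.eq_empty_or_nonempty {g : OrthGroup n G | g.val h = v} with he | ⟨g₀, hg₀⟩
    · rw [he]; exact Set.finite_empty
    refine (hstab.image (g₀ * ·)).subset fun g hg => ⟨g₀⁻¹ * g, ?_, mul_inv_cancel_left _ _⟩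
    have h1 : g₀.val h = v := hg₀
    have h2 : g.val h = v := hg
    change g₀.val.symm (g.val h) = h
    rw [h2, ← h1, LinearEquiv.symm_apply_apply]
  set F := {v | (∀ i, 0 ≤ bform G v (α i)) ∧ bform G v v = bform G h h}
  have hF : F.Finite := finite_nonneg_norm_eq hG hneg hP hh
  have hK : (⋃ v ∈ F ∪ -F, {g : OrthGroup n G | g.val h = v}).Finite :=
    (hF.union hF.neg).biUnion fun v _ => hfib v
  set K := ⋃ v ∈ F ∪ -F, {g : OrthGroup n G | g.val h = v}
  have hcover : ∀ g : OrthGroup n G, ∃ w ∈ Wr n G, w * g ∈ K := by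
    intro g
    have hv : 0 < bform G (g.val h) (g.val h) := (g.2 h h).symm ▸ hh
    rcases lt_trichotomy (bform G (g.val h) h) 0 with hlt | heq | hgt
    · obtain ⟨w, hw, hwP⟩ := exists_mem_Wr_nonneg hG hα hαh hneg (-g.val h)
        (by rwa [bform_neg_left, bform_neg_right, neg_neg])
        (by rw [bform_neg_left]; omega)
      refine ⟨w, hw, Set.mem_biUnion (x := w.val (g.val h)) (Or.inr ⟨?_, ?_⟩) rfl⟩
      · simpa using hwP
      · rw [bform_neg_left, bform_neg_right, neg_neg]
        exact (w.2 _ _).trans (g.2 _ _)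
    · exact absurd (hneg _ heq) (not_le.2 hv)
    · obtain ⟨w, hw, hwP⟩ := exists_mem_Wr_nonneg hG hα hαh hneg (g.val h) hv hgt
      exact ⟨w, hw, Set.mem_biUnion (x := w.val (g.val h))
        (Or.inl ⟨hwP, (w.2 _ _).trans (g.2 _ _)⟩) rfl⟩
  have : Finite K := hK
  have : Finite (OrthGroup n G ⧸ Wr n G) := by
    refine Finite.of_surjective (fun k : K => ((k.1⁻¹ : OrthGroup n G) : OrthGroup n G ⧸ Wr n G)) ?_
    intro q
    obtain ⟨g, rfl⟩ := QuotientGroup.mk_surjective q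
    obtain ⟨w, hw, hk⟩ := hcover g⁻¹
    refine ⟨⟨w * g⁻¹, hk⟩, QuotientGroup.eq.2 ?_⟩
    simpa using hw
  exact Subgroup.finiteIndex_of_finite_quotient

end BilinearForm

/-- Five mutually orthogonal roots, the vertices of `K₅`. -/
def vertexRoot : Fin 5 → Fin 15 → ℤ :=
  ![![0, 0, 0, 0, 1, 0, 0, 0, 0, 0, 0, 0, 0, 0, 0],
    ![0, 0, 0, 0, 0, 0, 0, 0, 1, 0, 0, 0, 0, 0, 0],
    ![0, 0, 0, 0, 0, 0, 0, 0, 0, 0, 0, 0, 1, 0, 0],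
    ![-1, 1, 0, 0, 0, 0, 0, 0, 0, 0, 0, 0, 0, 0, 0],
    ![3, 3, 2, 0, 1, 0, 2, 0, 1, 0, 2, 0, 1, 0, 1]]

/-- Ten mutually orthogonal roots, the edges of `K₅`. -/
def edgeRoot : Fin 5 → Fin 5 → Fin 15 → ℤ :=
  ![![0,
      ![2, 2, 1, 0, 0, 0, 1, 0, 0, 0, 1, -1, 0, 0, 1],
      ![2, 2, 1, 0, 0, 0, 1, -1, 0, 0, 1, 0, 0, 0, 1],
      ![1, 0, 1, 0, 0, 0, 0, 0, 0, 0, 0, 0, 0, 0, 0],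
      ![0, 0, 0, 0, 0, 1, 0, 0, 0, 0, 0, 0, 0, 0, 0]],
    ![![2, 2, 1, 0, 0, 0, 1, 0, 0, 0, 1, -1, 0, 0, 1],
      0,
      ![2, 2, 1, -1, 0, 0, 1, 0, 0, 0, 1, 0, 0, 0, 1],
      ![1, 0, 0, 0, 0, 0, 1, 0, 0, 0, 0, 0, 0, 0, 0],
      ![0, 0, 0, 0, 0, 0, 0, 0, 0, 1, 0, 0, 0, 0, 0]],
    ![![2, 2, 1, 0, 0, 0, 1, -1, 0, 0, 1, 0, 0, 0, 1],
      ![2, 2, 1, -1, 0, 0, 1, 0, 0, 0, 1, 0, 0, 0, 1],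
      0,
      ![1, 0, 0, 0, 0, 0, 0, 0, 0, 0, 1, 0, 0, 0, 0],
      ![0, 0, 0, 0, 0, 0, 0, 0, 0, 0, 0, 0, 0, 1, 0]],
    ![![1, 0, 1, 0, 0, 0, 0, 0, 0, 0, 0, 0, 0, 0, 0],
      ![1, 0, 0, 0, 0, 0, 1, 0, 0, 0, 0, 0, 0, 0, 0],
      ![1, 0, 0, 0, 0, 0, 0, 0, 0, 0, 1, 0, 0, 0, 0],
      0,
      ![1, 0, 0, 0, 0, 0, 0, 0, 0, 0, 0, 0, 0, 0, 1]],
    ![![0, 0, 0, 0, 0, 1, 0, 0, 0, 0, 0, 0, 0, 0, 0],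
      ![0, 0, 0, 0, 0, 0, 0, 0, 0, 1, 0, 0, 0, 0, 0],
      ![0, 0, 0, 0, 0, 0, 0, 0, 0, 0, 0, 0, 0, 1, 0],
      ![1, 0, 0, 0, 0, 0, 0, 0, 0, 0, 0, 0, 0, 0, 1],
      0]]

/-- The roots cutting out the fundamental chamber: the five types are the orbits of the
symmetric group of `K₅`. -/
def chamberRoot : Fin 5 × Equiv.Perm (Fin 5) → Fin 15 → ℤ := fun t =>
  let a := fun i => vertexRoot (t.2 i)
  let b := fun i j => edgeRoot (t.2 i) (t.2 j)
  ![a 0, b 0 1,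
    -a 0 - a 1 + a 2 + a 3 + a 4 - (2 : ℤ) • b 0 1 + b 2 3 + b 2 4 + b 3 4,
    -a 0 + a 1 + a 2 + a 3 + a 4 + b 1 3 + b 1 4 + b 2 3 + b 2 4,
    -a 0 + (3 : ℤ) • a 1 + a 2 + a 3 + a 4 + (2 : ℤ) • (b 1 2 + b 1 3 + b 1 4)] t.1

/-- A lattice vector in the interior of the fundamental chamber. -/
def interiorVector : Fin 15 → ℤ := ![26, 24, 14, -2, 6, 2, 14, -2, 6, 2, 14, -2, 6, 2, 11]

lemma gramS_eq : gramS =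
    !![0, 1, 0, 0, 0, 0, 0, 0, 0, 0, 0, 0, 0, 0, 0;
      1, 0, 0, 0, 0, 0, 0, 0, 0, 0, 0, 0, 0, 0, 0;
      0, 0, -2, 0, 1, 0, 0, 0, 0, 0, 0, 0, 0, 0, 0;
      0, 0, 0, -2, 1, 0, 0, 0, 0, 0, 0, 0, 0, 0, 0;
      0, 0, 1, 1, -2, 1, 0, 0, 0, 0, 0, 0, 0, 0, 0;
      0, 0, 0, 0, 1, -2, 0, 0, 0, 0, 0, 0, 0, 0, 0;
      0, 0, 0, 0, 0, 0, -2, 0, 1, 0, 0, 0, 0, 0, 0;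
      0, 0, 0, 0, 0, 0, 0, -2, 1, 0, 0, 0, 0, 0, 0;
      0, 0, 0, 0, 0, 0, 1, 1, -2, 1, 0, 0, 0, 0, 0;
      0, 0, 0, 0, 0, 0, 0, 0, 1, -2, 0, 0, 0, 0, 0;
      0, 0, 0, 0, 0, 0, 0, 0, 0, 0, -2, 0, 1, 0, 0;
      0, 0, 0, 0, 0, 0, 0, 0, 0, 0, 0, -2, 1, 0, 0;
      0, 0, 0, 0, 0, 0, 0, 0, 0, 0, 1, 1, -2, 1, 0;
      0, 0, 0, 0, 0, 0, 0, 0, 0, 0, 0, 0, 1, -2, 0;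
      0, 0, 0, 0, 0, 0, 0, 0, 0, 0, 0, 0, 0, 0, -2] := by
  decide +kernel

lemma isSymm_gramS : gramS.IsSymm := by
  rw [gramS_eq]
  decide +kernel

lemma bform_gramS (x y : Fin 15 → ℤ) : bform gramS x y =
    x 0 * y 1 + x 1 * y 0 +
    (x 2 * (y 4 - 2 * y 2) + x 3 * (y 4 - 2 * y 3) + x 4 * (y 2 + y 3 + y 5 - 2 * y 4) +
      x 5 * (y 4 - 2 * y 5)) +
    (x 6 * (y 8 - 2 * y 6) + x 7 * (y 8 - 2 * y 7) + x 8 * (y 6 + y 7 + y 9 - 2 * y 8) +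
      x 9 * (y 8 - 2 * y 9)) +
    (x 10 * (y 12 - 2 * y 10) + x 11 * (y 12 - 2 * y 11) +
      x 12 * (y 10 + y 11 + y 13 - 2 * y 12) + x 13 * (y 12 - 2 * y 13)) -
    2 * x 14 * y 14 := by
  rw [gramS_eq]
  simp [bform, dotProduct, mulVec, Fin.sum_univ_succ]
  ring

lemma two_dvd_bform_gramS {α : Fin 15 → ℤ}
    (h : 2 ∣ α 0 ∧ 2 ∣ α 1 ∧ (2 ∣ α 4 ∧ 2 ∣ α 2 + α 3 + α 5) ∧
      (2 ∣ α 8 ∧ 2 ∣ α 6 + α 7 + α 9) ∧ 2 ∣ α 12 ∧ 2 ∣ α 10 + α 11 + α 13) (x : Fin 15 → ℤ) :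
    2 ∣ bform gramS α x := by
  obtain ⟨⟨c₀, h₀⟩, ⟨c₁, h₁⟩, ⟨⟨c₂, h₂⟩, c₃, h₃⟩, ⟨⟨c₄, h₄⟩, c₅, h₅⟩, ⟨c₆, h₆⟩, c₇, h₇⟩ := h
  rw [bform_comm isSymm_gramS, bform_gramS, h₀, h₁, h₂, h₃, h₄, h₅, h₆, h₇]
  exact ⟨x 0 * c₁ + x 1 * c₀ +
    (x 2 * (c₂ - α 2) + x 3 * (c₂ - α 3) + x 4 * (c₃ - 2 * c₂) + x 5 * (c₂ - α 5)) +
    (x 6 * (c₄ - α 6) + x 7 * (c₄ - α 7) + x 8 * (c₅ - 2 * c₄) + x 9 * (c₄ - α 9)) +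
    (x 10 * (c₆ - α 10) + x 11 * (c₆ - α 11) + x 12 * (c₇ - 2 * c₆) + x 13 * (c₆ - α 13)) -
    x 14 * α 14, by ring⟩

lemma bform_vertexRoot_vertexRoot (i j : Fin 5) :
    bform gramS (vertexRoot i) (vertexRoot j) = if i = j then -2 else 0 := by
  rw [bform_gramS]
  revert i j
  decide +kernel

lemma bform_vertexRoot_edgeRoot (i j k : Fin 5) :
    bform gramS (vertexRoot i) (edgeRoot j k) = if j ≠ k ∧ (i = j ∨ i = k) then 1 else 0 := by
  rw [bform_gramS]
  revert i j k
  decide +kernel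

lemma bform_edgeRoot_edgeRoot (i j k l : Fin 5) :
    bform gramS (edgeRoot i j) (edgeRoot k l) =
      if i ≠ j ∧ (i = k ∧ j = l ∨ i = l ∧ j = k) then -2 else 0 := by
  rw [bform_gramS]
  revert i j k l
  decide +kernel

lemma bform_chamberRoot_self (t : Fin 5 × Equiv.Perm (Fin 5)) :
    bform gramS (chamberRoot t) (chamberRoot t) = if t.1 = 2 then -4 else -2 := by
  obtain ⟨k, σ⟩ := t
  fin_cases k <;>
  simp [-zsmul_eq_mul, -smul_eq_mul, chamberRoot, bform_add_left, bform_sub_left, bform_neg_left,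
    bform_smul_left, bform_add_right, bform_sub_right, bform_neg_right, bform_smul_right,
    bform_vertexRoot_vertexRoot, bform_vertexRoot_edgeRoot, bform_edgeRoot_edgeRoot,
    bform_comm isSymm_gramS (edgeRoot _ _) (vertexRoot _)]

/-- The sum of the five vertex roots and the three sides of a triangle is divisible by `2` in the
dual lattice. -/
lemma two_dvd_bform_triangle {k l m : Fin 5} (hkl : k ≠ l) (hkm : k ≠ m) (hlm : l ≠ m)
    (x : Fin 15 → ℤ) :
    2 ∣ bform gramS (∑ i, vertexRoot i + edgeRoot k l + edgeRoot k m + edgeRoot l m) x := by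
  refine two_dvd_bform_gramS ?_ x
  have hv : ∑ i, vertexRoot i = ![2, 4, 2, 0, 2, 0, 2, 0, 2, 0, 2, 0, 2, 0, 1] := by
    decide +kernel
  rw [hv]
  clear hv
  revert k l m
  decide +kernel

lemma isRoot_chamberRoot (t : Fin 5 × Equiv.Perm (Fin 5)) : IsRoot gramS (chamberRoot t) := by
  have hn := bform_chamberRoot_self t
  obtain ⟨k, σ⟩ := t
  by_cases hk : k = 2
  · subst hk
    refine Or.inr ⟨hn, fun x => ?_⟩
    have hc : chamberRoot (2, σ) = ∑ i, vertexRoot i + edgeRoot (σ 2) (σ 3) +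
        edgeRoot (σ 2) (σ 4) + edgeRoot (σ 3) (σ 4) -
        (2 : ℤ) • (vertexRoot (σ 0) + vertexRoot (σ 1) + edgeRoot (σ 0) (σ 1)) := by
      rw [← Equiv.sum_comp σ, Fin.sum_univ_five]
      simp only [chamberRoot, Matrix.cons_val]
      module
    rw [hc, bform_sub_left, bform_smul_left]
    have hne : ∀ {i j : Fin 5}, i ≠ j → σ i ≠ σ j := σ.injective.ne
    exact dvd_sub (two_dvd_bform_triangle (hne (by decide)) (hne (by decide)) (hne (by decide)) x)
      (dvd_mul_right _ _)
  · exact Or.inl (by simpa [hk] using hn)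

/-- The part of the fundamental chamber on which the coordinate of one vertex dominates. -/
structure ReducedChamber (s y₁ y₂ y₃ y₄ b₁ b₂ b₃ b₄ g₁₂ g₁₃ g₁₄ g₂₃ g₂₄ g₃₄ : ℚ) : Prop where
  b1 : 0 ≤ b₁
  yb1 : 0 ≤ y₁ - b₁
  a1 : 0 ≤ s - y₁ - b₁ - g₁₂ - g₁₃ - g₁₄
  e1 : 0 ≤ 2 * s - y₁ - b₁ - g₂₃ - g₂₄ - g₃₄
  b2 : 0 ≤ b₂
  yb2 : 0 ≤ y₂ - b₂
  a2 : 0 ≤ s - y₂ - b₂ - g₁₂ - g₂₃ - g₂₄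
  e2 : 0 ≤ 2 * s - y₂ - b₂ - g₁₃ - g₁₄ - g₃₄
  b3 : 0 ≤ b₃
  yb3 : 0 ≤ y₃ - b₃
  a3 : 0 ≤ s - y₃ - b₃ - g₁₃ - g₂₃ - g₃₄
  e3 : 0 ≤ 2 * s - y₃ - b₃ - g₁₂ - g₁₄ - g₂₄
  b4 : 0 ≤ b₄
  yb4 : 0 ≤ y₄ - b₄
  a4 : 0 ≤ s - y₄ - b₄ - g₁₄ - g₂₄ - g₃₄
  e4 : 0 ≤ 2 * s - y₄ - b₄ - g₁₂ - g₁₃ - g₂₃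
  g12 : 0 ≤ g₁₂
  c12 : 0 ≤ s - y₃ - y₄ - g₁₂
  g13 : 0 ≤ g₁₃
  c13 : 0 ≤ s - y₂ - y₄ - g₁₃
  g14 : 0 ≤ g₁₄
  c14 : 0 ≤ s - y₂ - y₃ - g₁₄
  g23 : 0 ≤ g₂₃
  c23 : 0 ≤ s - y₁ - y₄ - g₂₃
  g24 : 0 ≤ g₂₄
  c24 : 0 ≤ s - y₁ - y₃ - g₂₄
  g34 : 0 ≤ g₃₄
  c34 : 0 ≤ s - y₁ - y₂ - g₃₄
  dA : 0 ≤ s - g₁₂ - g₃₄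
  dB : 0 ≤ s - g₁₃ - g₂₄
  dC : 0 ≤ s - g₁₄ - g₂₃
  r : 0 ≤ s - y₁ - y₂ - y₃ - y₄

/-- The sum of the squares of the reduced coordinates. -/
def normSum (y₁ y₂ y₃ y₄ b₁ b₂ b₃ b₄ g₁₂ g₁₃ g₁₄ g₂₃ g₂₄ g₃₄ : ℚ) : ℚ :=
  y₁ ^ 2 + y₂ ^ 2 + y₃ ^ 2 + y₄ ^ 2 + b₁ ^ 2 + b₂ ^ 2 + b₃ ^ 2 + b₄ ^ 2 +
    g₁₂ ^ 2 + g₁₃ ^ 2 + g₁₄ ^ 2 + g₂₃ ^ 2 + g₂₄ ^ 2 + g₃₄ ^ 2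

section ReducedChamber

variable {s y₁ y₂ y₃ y₄ b₁ b₂ b₃ b₄ g₁₂ g₁₃ g₁₄ g₂₃ g₂₄ g₃₄ : ℚ}

lemma ReducedChamber.normSum_le_pos_pos_pos
    (h : ReducedChamber s y₁ y₂ y₃ y₄ b₁ b₂ b₃ b₄ g₁₂ g₁₃ g₁₄ g₂₃ g₂₄ g₃₄)
    (hαβ : 0 ≤ g₁₂ + g₃₄ - g₁₃ - g₂₄)
    (hβδ : 0 ≤ g₁₃ + g₂₄ - g₁₄ - g₂₃)
    (hy₂ : 0 ≤ y₁ - y₂)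
    (hy₃ : 0 ≤ y₁ - y₃)
    (hy₄ : 0 ≤ y₁ - y₄)
    (hG : 0 ≤ g₁₂ + g₁₃ + g₁₄ + g₂₃ + g₂₄ + g₃₄ - s)
    (hp : 0 ≤ g₁₃ + g₂₄ - y₃ - y₄ - g₁₂)
    (hq : 0 ≤ s + g₁₃ - y₁ - b₁ - g₂₃ - g₃₄)
    (hr : 0 ≤ y₁ + y₄ - y₂ - b₂ - g₁₂ - g₂₄) :
    normSum y₁ y₂ y₃ y₄ b₁ b₂ b₃ b₄ g₁₂ g₁₃ g₁₄ g₂₃ g₂₄ g₃₄ ≤ s ^ 2 := by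
  unfold normSum
  linear_combination
    (1641731963/1985358874) * mul_nonneg h.b1 h.yb1 +
    (543398975/3970717748) * mul_nonneg h.b1 h.a1 +
    (216412/14816111) * mul_nonneg h.b1 h.a3 +
    (302870105/1985358874) * mul_nonneg h.b1 h.c34 +
    (306101607/1985358874) * mul_nonneg h.b1 h.r +
    (75604447/992679437) * mul_nonneg h.b1 hG +
    (1273209/1985358874) * mul_nonneg h.b1 hp +
    (190786245/992679437) * mul_nonneg h.b1 hq +
    (28423732/992679437) * mul_nonneg h.yb1 h.b2 +
    (8747100/992679437) * mul_nonneg h.yb1 h.g14 +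
    (73820633/3970717748) * mul_nonneg h.a1 h.b2 +
    (4287672/992679437) * mul_nonneg h.a1 h.yb3 +
    (534226887/1985358874) * mul_nonneg h.a1 h.g12 +
    (127636021/992679437) * mul_nonneg h.a1 h.g13 +
    (835800313/3970717748) * mul_nonneg h.a1 h.g14 +
    (505175685/3970717748) * mul_nonneg h.a1 h.dA +
    (492479767/3970717748) * mul_nonneg h.a1 hβδ +
    (494115807/3970717748) * mul_nonneg h.a1 hy₂ +
    (262493077/992679437) * mul_nonneg h.a1 hy₃ +
    (86927337/3970717748) * mul_nonneg h.a1 hy₄ +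
    (619290133/3970717748) * mul_nonneg h.a1 hq +
    (187515561/3970717748) * mul_nonneg h.a1 hr +
    (28753981/992679437) * mul_nonneg h.e1 h.yb3 +
    (808946534/992679437) * mul_nonneg h.b2 h.yb2 +
    (94432767/992679437) * mul_nonneg h.b2 h.a3 +
    (52502924/992679437) * mul_nonneg h.b2 h.a4 +
    (676516483/992679437) * mul_nonneg h.b2 h.c13 +
    (363657476/992679437) * mul_nonneg h.b2 h.c34 +
    (268216475/992679437) * mul_nonneg h.b2 h.r +
    (24973931/992679437) * mul_nonneg h.b2 hβδ +
    (676968440/992679437) * mul_nonneg h.b2 hG +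
    (338484220/992679437) * mul_nonneg h.b2 hr +
    (96385272/992679437) * mul_nonneg h.yb2 h.a2 +
    (34465821/992679437) * mul_nonneg h.yb2 h.e3 +
    (666005/29632222) * mul_nonneg h.yb2 h.e4 +
    (384919416/992679437) * mul_nonneg h.yb2 h.c13 +
    (77491937/992679437) * mul_nonneg h.yb2 h.g14 +
    (41755194/992679437) * mul_nonneg h.yb2 h.c24 +
    (170080407/992679437) * mul_nonneg h.yb2 h.c34 +
    (86305641/992679437) * mul_nonneg h.yb2 h.r +
    (196622656/992679437) * mul_nonneg h.yb2 hy₂ +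
    (660876607/1985358874) * mul_nonneg h.yb2 hG +
    (871135/14816111) * mul_nonneg h.yb2 hr +
    (160644725/992679437) * mul_nonneg h.a2 h.a3 +
    (60383513/1985358874) * mul_nonneg h.a2 h.a4 +
    (6316942/992679437) * mul_nonneg h.a2 h.g12 +
    (503000471/992679437) * mul_nonneg h.a2 h.g23 +
    (5349293/992679437) * mul_nonneg h.e2 h.yb3 +
    (492212234/992679437) * mul_nonneg h.b3 h.yb3 +
    (420914562/992679437) * mul_nonneg h.b3 h.a3 +
    (242563057/992679437) * mul_nonneg h.b3 h.e3 +
    (83757949/1985358874) * mul_nonneg h.b3 h.a4 +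
    (133800453/992679437) * mul_nonneg h.b3 h.c14 +
    (820647550/992679437) * mul_nonneg h.b3 h.c24 +
    (88079292/992679437) * mul_nonneg h.b3 hβδ +
    (335771506/992679437) * mul_nonneg h.b3 hG +
    (210013251/992679437) * mul_nonneg h.b3 hp +
    (79806461/992679437) * mul_nonneg h.b3 hq +
    (150854226/992679437) * mul_nonneg h.b3 hr +
    (163010416/992679437) * mul_nonneg h.yb3 h.a3 +
    (46086702/992679437) * mul_nonneg h.yb3 h.b4 +
    (57899477/992679437) * mul_nonneg h.yb3 h.c12 +
    (72947629/992679437) * mul_nonneg h.yb3 h.c14 +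
    (634936132/992679437) * mul_nonneg h.yb3 h.g24 +
    (681795545/992679437) * mul_nonneg h.yb3 h.c24 +
    (270055179/992679437) * mul_nonneg h.yb3 hy₃ +
    (61264412/992679437) * mul_nonneg h.yb3 hq +
    (175931353/1985358874) * mul_nonneg h.a3 h.a4 +
    (404138917/992679437) * mul_nonneg h.a3 h.g13 +
    (160644725/992679437) * mul_nonneg h.a3 h.g23 +
    (253028809/992679437) * mul_nonneg h.a3 h.c24 +
    (174866986/992679437) * mul_nonneg h.a3 h.g34 +
    (669062/14816111) * mul_nonneg h.a3 hr +
    (35351699/992679437) * mul_nonneg h.e3 h.c34 +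
    (1862203421/1985358874) * mul_nonneg h.b4 h.yb4 +
    (372224190/992679437) * mul_nonneg h.b4 h.a4 +
    (193129663/992679437) * mul_nonneg h.b4 h.c13 +
    (449422704/992679437) * mul_nonneg h.b4 h.c23 +
    (57885270/992679437) * mul_nonneg h.b4 h.r +
    (171879170/992679437) * mul_nonneg h.b4 hy₄ +
    (110674573/992679437) * mul_nonneg h.b4 hG +
    (175203961/992679437) * mul_nonneg h.b4 hp +
    (621292927/1985358874) * mul_nonneg h.yb4 h.a4 +
    (84647077/1985358874) * mul_nonneg h.yb4 h.g14 +
    (143335693/992679437) * mul_nonneg h.yb4 h.g23 +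
    (481900855/1985358874) * mul_nonneg h.yb4 h.c23 +
    (243134344/992679437) * mul_nonneg h.yb4 h.c34 +
    (205554871/992679437) * mul_nonneg h.yb4 hy₄ +
    (15600635/1985358874) * mul_nonneg h.yb4 hG +
    (42137949/992679437) * mul_nonneg h.yb4 hp +
    (259498543/1985358874) * mul_nonneg h.a4 h.g14 +
    (130676920/992679437) * mul_nonneg h.a4 h.g24 +
    (113797807/1985358874) * mul_nonneg h.a4 h.c24 +
    (744793099/1985358874) * mul_nonneg h.a4 h.g34 +
    (130776281/992679437) * mul_nonneg h.a4 hβδ +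
    (467285956/992679437) * mul_nonneg h.g12 h.g14 +
    (3823088/14816111) * mul_nonneg h.g12 h.g34 +
    (405777807/992679437) * mul_nonneg h.g12 hp +
    (134078014/992679437) * mul_nonneg h.c13 hq +
    (324773063/992679437) * mul_nonneg h.g14 h.c14 +
    (56227058/992679437) * mul_nonneg h.g14 h.g23 +
    (583103247/992679437) * mul_nonneg h.g14 hβδ +
    (42961642/992679437) * mul_nonneg h.g14 hr +
    (341417893/992679437) * mul_nonneg h.g23 h.c23 +
    (107258635/992679437) * mul_nonneg h.g23 hαβ +
    (148261073/992679437) * mul_nonneg h.g23 hq +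
    (193389726/992679437) * mul_nonneg h.c23 hr +
    (527751874/992679437) * mul_nonneg h.g24 h.c24 +
    (211746949/992679437) * mul_nonneg h.g34 h.c34 +
    (76671585/992679437) * mul_nonneg h.c34 hαβ +
    (454723041/992679437) * mul_nonneg h.c34 hy₄ +
    (211898754/992679437) * mul_nonneg h.dA hαβ +
    (33064290/992679437) * mul_nonneg h.dA hG +
    (48884010/992679437) * mul_nonneg h.dB hG +
    (44756450/992679437) * mul_nonneg hy₄ hq +
    (241681012/992679437) * mul_nonneg hG hr

lemma ReducedChamber.normSum_le_pos_pos_neg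
    (h : ReducedChamber s y₁ y₂ y₃ y₄ b₁ b₂ b₃ b₄ g₁₂ g₁₃ g₁₄ g₂₃ g₂₄ g₃₄)
    (hαβ : 0 ≤ g₁₂ + g₃₄ - g₁₃ - g₂₄)
    (hβδ : 0 ≤ g₁₃ + g₂₄ - g₁₄ - g₂₃)
    (hy₂ : 0 ≤ y₁ - y₂)
    (hy₃ : 0 ≤ y₁ - y₃)
    (hy₄ : 0 ≤ y₁ - y₄)
    (hG : 0 ≤ g₁₂ + g₁₃ + g₁₄ + g₂₃ + g₂₄ + g₃₄ - s)
    (hp : 0 ≤ g₁₃ + g₂₄ - y₃ - y₄ - g₁₂)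
    (hq : 0 ≤ s + g₁₃ - y₁ - b₁ - g₂₃ - g₃₄)
    (hr : 0 ≤ -(y₁ + y₄ - y₂ - b₂ - g₁₂ - g₂₄)) :
    normSum y₁ y₂ y₃ y₄ b₁ b₂ b₃ b₄ g₁₂ g₁₃ g₁₄ g₂₃ g₂₄ g₃₄ ≤ s ^ 2 := by
  unfold normSum
  linear_combination
    (5395/6737) * mul_nonneg h.b1 h.yb1 +
    (5546/20211) * mul_nonneg h.b1 h.a1 +
    (1096/20211) * mul_nonneg h.b1 h.yb4 +
    (203/6737) * mul_nonneg h.b1 h.a4 +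
    (460/20211) * mul_nonneg h.b1 h.c34 +
    (1448/20211) * mul_nonneg h.b1 h.r +
    (106/6737) * mul_nonneg h.b1 hαβ +
    (1448/6737) * mul_nonneg h.b1 hG +
    (5792/20211) * mul_nonneg h.b1 hq +
    (27139/161688) * mul_nonneg h.yb1 h.a1 +
    (6791/40422) * mul_nonneg h.yb1 h.b3 +
    (1103/20211) * mul_nonneg h.yb1 h.g14 +
    (5443/80844) * mul_nonneg h.a1 h.b2 +
    (6791/40422) * mul_nonneg h.a1 h.yb3 +
    (1705/20211) * mul_nonneg h.a1 h.yb4 +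
    (13511/80844) * mul_nonneg h.a1 h.g12 +
    (1859/6737) * mul_nonneg h.a1 h.g13 +
    (24353/161688) * mul_nonneg h.a1 h.g14 +
    (489/26948) * mul_nonneg h.a1 hβδ +
    (3229/13474) * mul_nonneg h.a1 hy₃ +
    (3443/161688) * mul_nonneg h.a1 hy₄ +
    (13765/161688) * mul_nonneg h.a1 hG +
    (31357/161688) * mul_nonneg h.a1 hq +
    (10637/161688) * mul_nonneg h.a1 hr +
    (5598/6737) * mul_nonneg h.b2 h.yb2 +
    (3647/20211) * mul_nonneg h.b2 h.a3 +
    (1936/20211) * mul_nonneg h.b2 h.g12 +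
    (32858/20211) * mul_nonneg h.b2 h.c34 +
    (533/20211) * mul_nonneg h.b2 h.r +
    (2063/20211) * mul_nonneg h.b2 hαβ +
    (7261/20211) * mul_nonneg h.b2 hy₂ +
    (7261/20211) * mul_nonneg h.b2 hG +
    (50819/323376) * mul_nonneg h.yb2 h.yb3 +
    (36095/646752) * mul_nonneg h.yb2 h.a3 +
    (2457/215584) * mul_nonneg h.yb2 h.e3 +
    (2380/6737) * mul_nonneg h.yb2 h.b4 +
    (2471/20211) * mul_nonneg h.yb2 h.yb4 +
    (8533/53896) * mul_nonneg h.yb2 h.g14 +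
    (13685/53896) * mul_nonneg h.yb2 h.c24 +
    (14645/107792) * mul_nonneg h.yb2 h.g34 +
    (91667/107792) * mul_nonneg h.yb2 h.c34 +
    (973/53896) * mul_nonneg h.yb2 hαβ +
    (104887/323376) * mul_nonneg h.yb2 hy₂ +
    (51235/646752) * mul_nonneg h.yb2 hG +
    (21523/161688) * mul_nonneg h.yb2 hq +
    (5265/13474) * mul_nonneg h.a2 h.b3 +
    (1024/6737) * mul_nonneg h.a2 h.yb3 +
    (3938/20211) * mul_nonneg h.a2 h.a3 +
    (13/20211) * mul_nonneg h.a2 h.yb4 +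
    (25409/80844) * mul_nonneg h.a2 h.g23 +
    (830/6737) * mul_nonneg h.a2 h.g24 +
    (6949/20211) * mul_nonneg h.a2 h.c34 +
    (1139/6737) * mul_nonneg h.a2 hr +
    (400/20211) * mul_nonneg h.e2 h.yb4 +
    (27803/40422) * mul_nonneg h.b3 h.yb3 +
    (28615/40422) * mul_nonneg h.b3 h.a3 +
    (29146/20211) * mul_nonneg h.b3 h.b4 +
    (6791/13474) * mul_nonneg h.b3 h.yb4 +
    (6791/40422) * mul_nonneg h.b3 h.a4 +
    (3912/6737) * mul_nonneg h.b3 h.g23 +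
    (20114/20211) * mul_nonneg h.b3 h.c24 +
    (721/6737) * mul_nonneg h.b3 hy₃ +
    (4774/6737) * mul_nonneg h.b3 hp +
    (2666/6737) * mul_nonneg h.yb3 h.a3 +
    (5188/6737) * mul_nonneg h.yb3 h.b4 +
    (159/26948) * mul_nonneg h.yb3 h.g23 +
    (3320/6737) * mul_nonneg h.yb3 h.c24 +
    (5422/20211) * mul_nonneg h.yb3 h.c34 +
    (4283/20211) * mul_nonneg h.yb3 h.dA +
    (3956/6737) * mul_nonneg h.yb3 hy₃ +
    (927/6737) * mul_nonneg h.yb3 hp +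
    (3877/20211) * mul_nonneg h.a3 h.g13 +
    (5893/26948) * mul_nonneg h.a3 h.g23 +
    (7646/20211) * mul_nonneg h.a3 h.c24 +
    (4750/20211) * mul_nonneg h.a3 hp +
    (6532/6737) * mul_nonneg h.b4 h.yb4 +
    (205/6737) * mul_nonneg h.b4 h.a4 +
    (15413/20211) * mul_nonneg h.b4 h.c13 +
    (500/20211) * mul_nonneg h.b4 h.c23 +
    (3134/6737) * mul_nonneg h.b4 hαβ +
    (188/20211) * mul_nonneg h.b4 hG +
    (8619/6737) * mul_nonneg h.b4 hp +
    (4256/20211) * mul_nonneg h.b4 hr +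
    (883/20211) * mul_nonneg h.yb4 h.c12 +
    (2025/6737) * mul_nonneg h.yb4 h.c13 +
    (6565/20211) * mul_nonneg h.yb4 h.g23 +
    (2288/6737) * mul_nonneg h.yb4 h.c23 +
    (17/6737) * mul_nonneg h.yb4 h.g34 +
    (1271/6737) * mul_nonneg h.yb4 hy₄ +
    (5993/20211) * mul_nonneg h.yb4 hp +
    (1678/20211) * mul_nonneg h.a4 h.g14 +
    (3629/6737) * mul_nonneg h.a4 h.g24 +
    (3108/6737) * mul_nonneg h.a4 h.g34 +
    (1139/6737) * mul_nonneg h.a4 hp +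
    (16031/20211) * mul_nonneg h.g14 h.g23 +
    (1642/6737) * mul_nonneg h.g14 hαβ +
    (18533/20211) * mul_nonneg h.g14 hβδ +
    (3241/20211) * mul_nonneg h.g14 hy₂ +
    (1157/6737) * mul_nonneg h.g14 hy₃ +
    (1466/6737) * mul_nonneg h.g14 hG +
    (1394/20211) * mul_nonneg h.g14 hp +
    (15595/40422) * mul_nonneg h.g23 h.c23 +
    (3219/13474) * mul_nonneg h.g23 h.c34 +
    (5949/26948) * mul_nonneg h.g23 hβδ +
    (1927/40422) * mul_nonneg h.g23 hp +
    (4471/80844) * mul_nonneg h.g23 hq +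
    (5980/20211) * mul_nonneg h.c24 hy₂ +
    (1490/20211) * mul_nonneg h.c24 hy₄ +
    (521/20211) * mul_nonneg h.c34 hαβ +
    (630/6737) * mul_nonneg h.c34 hy₃ +
    (200/6737) * mul_nonneg h.c34 hy₄ +
    (9845/20211) * mul_nonneg h.dA hαβ +
    (521/20211) * mul_nonneg h.dA hG +
    (1976/6737) * mul_nonneg hy₂ hq +
    (302/6737) * mul_nonneg hy₄ hq

lemma ReducedChamber.normSum_le_pos_neg_pos
    (h : ReducedChamber s y₁ y₂ y₃ y₄ b₁ b₂ b₃ b₄ g₁₂ g₁₃ g₁₄ g₂₃ g₂₄ g₃₄)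
    (hαβ : 0 ≤ g₁₂ + g₃₄ - g₁₃ - g₂₄)
    (hβδ : 0 ≤ g₁₃ + g₂₄ - g₁₄ - g₂₃)
    (hy₂ : 0 ≤ y₁ - y₂)
    (hy₄ : 0 ≤ y₁ - y₄)
    (hG : 0 ≤ g₁₂ + g₁₃ + g₁₄ + g₂₃ + g₂₄ + g₃₄ - s)
    (hp : 0 ≤ g₁₃ + g₂₄ - y₃ - y₄ - g₁₂)
    (hr : 0 ≤ 2 * b₁ + y₁ + g₂₃ + g₂₄ + g₃₄ - 2 * s) :
    normSum y₁ y₂ y₃ y₄ b₁ b₂ b₃ b₄ g₁₂ g₁₃ g₁₄ g₂₃ g₂₄ g₃₄ ≤ s ^ 2 := by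
  unfold normSum
  linear_combination
    (8/153) * mul_nonneg h.b1 h.yb1 +
    (43/102) * mul_nonneg h.b1 h.a1 +
    (131/612) * mul_nonneg h.b1 h.g14 +
    (157/102) * mul_nonneg h.yb1 h.b2 +
    1 * mul_nonneg h.yb1 h.yb2 +
    (55/102) * mul_nonneg h.yb1 h.a2 +
    (13/17) * mul_nonneg h.yb1 h.b3 +
    (26/51) * mul_nonneg h.yb1 h.yb3 +
    (3/17) * mul_nonneg h.yb1 h.a3 +
    (53/306) * mul_nonneg h.yb1 h.b4 +
    (19/153) * mul_nonneg h.yb1 h.yb4 +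
    (55/306) * mul_nonneg h.yb1 h.c23 +
    (13/51) * mul_nonneg h.yb1 h.c24 +
    (43/102) * mul_nonneg h.yb1 h.c34 +
    (8/153) * mul_nonneg h.yb1 hr +
    (19/102) * mul_nonneg h.a1 h.e1 +
    (1/34) * mul_nonneg h.a1 h.b2 +
    (2/51) * mul_nonneg h.a1 h.a2 +
    (31/153) * mul_nonneg h.a1 h.b3 +
    (13/306) * mul_nonneg h.a1 h.yb3 +
    (55/306) * mul_nonneg h.a1 h.a3 +
    (1/153) * mul_nonneg h.a1 h.b4 +
    (1/153) * mul_nonneg h.a1 h.yb4 +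
    (35/102) * mul_nonneg h.a1 h.g12 +
    (70/153) * mul_nonneg h.a1 h.g13 +
    (7/36) * mul_nonneg h.a1 h.g14 +
    (1/18) * mul_nonneg h.a1 hβδ +
    (1/102) * mul_nonneg h.e1 h.b2 +
    (1/17) * mul_nonneg h.e1 h.yb3 +
    (5/102) * mul_nonneg h.e1 h.yb4 +
    (20/51) * mul_nonneg h.e1 h.g23 +
    (31/102) * mul_nonneg h.e1 hr +
    (16/17) * mul_nonneg h.b2 h.yb2 +
    (47/51) * mul_nonneg h.b2 h.a2 +
    (47/51) * mul_nonneg h.b2 h.c34 +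
    (16/51) * mul_nonneg h.b2 h.r +
    (13/17) * mul_nonneg h.b2 hG +
    (44/51) * mul_nonneg h.yb2 h.a2 +
    (4/51) * mul_nonneg h.yb2 h.b3 +
    (4/51) * mul_nonneg h.yb2 h.yb3 +
    (4/51) * mul_nonneg h.yb2 h.g14 +
    (6/17) * mul_nonneg h.yb2 h.c34 +
    (5/17) * mul_nonneg h.yb2 h.r +
    (1/34) * mul_nonneg h.yb2 hβδ +
    (1/34) * mul_nonneg h.yb2 hy₂ +
    (1/2) * mul_nonneg h.yb2 hG +
    (1/51) * mul_nonneg h.yb2 hp +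
    (1/102) * mul_nonneg h.a2 h.g12 +
    (4/51) * mul_nonneg h.a2 h.c24 +
    (55/102) * mul_nonneg h.a2 h.c34 +
    (23/102) * mul_nonneg h.a2 hG +
    (47/51) * mul_nonneg h.b3 h.yb3 +
    (13/17) * mul_nonneg h.b3 h.a3 +
    (1/36) * mul_nonneg h.b3 h.a4 +
    (16/51) * mul_nonneg h.b3 h.g13 +
    (94/51) * mul_nonneg h.b3 h.c24 +
    (35/51) * mul_nonneg h.yb3 h.a3 +
    (1/51) * mul_nonneg h.yb3 h.e4 +
    (4/51) * mul_nonneg h.yb3 h.g14 +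
    1 * mul_nonneg h.yb3 h.c24 +
    (2/51) * mul_nonneg h.yb3 hαβ +
    (8/51) * mul_nonneg h.a3 h.b4 +
    (4/51) * mul_nonneg h.a3 h.yb4 +
    (53/612) * mul_nonneg h.a3 h.a4 +
    (16/51) * mul_nonneg h.a3 h.g13 +
    (35/51) * mul_nonneg h.a3 h.c24 +
    (145/153) * mul_nonneg h.b4 h.yb4 +
    (57/68) * mul_nonneg h.b4 h.a4 +
    (242/153) * mul_nonneg h.b4 h.c23 +
    (20/153) * mul_nonneg h.b4 hαβ +
    (16/153) * mul_nonneg h.b4 hβδ +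
    (32/51) * mul_nonneg h.b4 hG +
    (481/612) * mul_nonneg h.yb4 h.a4 +
    (1/17) * mul_nonneg h.yb4 h.g12 +
    (43/51) * mul_nonneg h.yb4 h.c23 +
    (4/51) * mul_nonneg h.yb4 hαβ +
    (37/102) * mul_nonneg h.yb4 hG +
    (385/612) * mul_nonneg h.a4 h.c23 +
    (7/612) * mul_nonneg h.a4 h.c24 +
    (13/204) * mul_nonneg h.a4 h.g34 +
    (1/68) * mul_nonneg h.a4 h.dC +
    (7/306) * mul_nonneg h.a4 hαβ +
    (23/204) * mul_nonneg h.a4 hβδ +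
    (4/17) * mul_nonneg h.a4 hG +
    (14/51) * mul_nonneg h.g12 h.g13 +
    (2/3) * mul_nonneg h.g12 h.g14 +
    (23/102) * mul_nonneg h.g12 h.dA +
    (10/51) * mul_nonneg h.g13 h.c23 +
    (29/102) * mul_nonneg h.g13 h.c34 +
    (2/17) * mul_nonneg h.g13 hαβ +
    (10/51) * mul_nonneg h.g13 hr +
    (14/153) * mul_nonneg h.g14 h.c23 +
    (16/51) * mul_nonneg h.g14 h.c24 +
    (41/102) * mul_nonneg h.g14 h.c34 +
    (83/612) * mul_nonneg h.g14 h.dC +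
    (29/204) * mul_nonneg h.g14 hαβ +
    (25/34) * mul_nonneg h.g14 hβδ +
    (2/17) * mul_nonneg h.g14 hG +
    (49/612) * mul_nonneg h.g14 hr +
    (4/51) * mul_nonneg h.g23 hβδ +
    (2/51) * mul_nonneg h.c23 h.c34 +
    (35/102) * mul_nonneg h.g34 h.c34 +
    (2/17) * mul_nonneg h.c34 hαβ +
    (2/51) * mul_nonneg h.c34 hβδ +
    (2/17) * mul_nonneg h.c34 hy₄ +
    (8/51) * mul_nonneg h.c34 hp +
    (4/17) * mul_nonneg hαβ hp

lemma ReducedChamber.normSum_le_pos_neg_neg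
    (h : ReducedChamber s y₁ y₂ y₃ y₄ b₁ b₂ b₃ b₄ g₁₂ g₁₃ g₁₄ g₂₃ g₂₄ g₃₄)
    (hαβ : 0 ≤ g₁₂ + g₃₄ - g₁₃ - g₂₄)
    (hβδ : 0 ≤ g₁₃ + g₂₄ - g₁₄ - g₂₃)
    (hy₂ : 0 ≤ y₁ - y₂)
    (hy₃ : 0 ≤ y₁ - y₃)
    (hy₄ : 0 ≤ y₁ - y₄)
    (hG : 0 ≤ g₁₂ + g₁₃ + g₁₄ + g₂₃ + g₂₄ + g₃₄ - s)
    (hp : 0 ≤ g₁₃ + g₂₄ - y₃ - y₄ - g₁₂)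
    (hq : 0 ≤ -(s + g₁₃ - y₁ - b₁ - g₂₃ - g₃₄))
    (hr : 0 ≤ -(2 * b₁ + y₁ + g₂₃ + g₂₄ + g₃₄ - 2 * s)) :
    normSum y₁ y₂ y₃ y₄ b₁ b₂ b₃ b₄ g₁₂ g₁₃ g₁₄ g₂₃ g₂₄ g₃₄ ≤ s ^ 2 := by
  unfold normSum
  linear_combination
    (763917/1708513) * mul_nonneg h.b1 h.yb1 +
    (120304/1708513) * mul_nonneg h.b1 h.a1 +
    (226199/3417026) * mul_nonneg h.b1 h.a4 +
    (6134047/6834052) * mul_nonneg h.yb1 h.b2 +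
    (109373/3417026) * mul_nonneg h.yb1 h.yb2 +
    (1338217/6834052) * mul_nonneg h.yb1 h.a2 +
    (888403/1708513) * mul_nonneg h.yb1 h.b3 +
    (1118161/6834052) * mul_nonneg h.yb1 h.c24 +
    (2430911/6834052) * mul_nonneg h.yb1 h.c34 +
    (97068/1708513) * mul_nonneg h.a1 h.yb2 +
    (4449473/6834052) * mul_nonneg h.a1 h.b3 +
    (4145879/13668104) * mul_nonneg h.a1 h.yb3 +
    (3485893/6834052) * mul_nonneg h.a1 h.a3 +
    (290707/6834052) * mul_nonneg h.a1 h.yb4 +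
    (83135/1708513) * mul_nonneg h.a1 h.a4 +
    (1096717/6834052) * mul_nonneg h.a1 h.g12 +
    (5940487/6834052) * mul_nonneg h.a1 h.g13 +
    (128791/20502156) * mul_nonneg h.a1 h.g14 +
    (60821/3417026) * mul_nonneg h.a1 hβδ +
    (59929/1708513) * mul_nonneg h.e1 hp +
    (2101839/3417026) * mul_nonneg h.b2 h.yb2 +
    (1929779/3417026) * mul_nonneg h.b2 h.a2 +
    (1380831/6834052) * mul_nonneg h.b2 h.a3 +
    (381845/6834052) * mul_nonneg h.b2 h.a4 +
    (1469084/1708513) * mul_nonneg h.b2 h.c34 +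
    (285991/3417026) * mul_nonneg h.b2 h.r +
    (544276/1708513) * mul_nonneg h.b2 hy₂ +
    (3065617/3417026) * mul_nonneg h.b2 hG +
    (469474/1708513) * mul_nonneg h.b2 hq +
    (307296/1708513) * mul_nonneg h.yb2 h.a2 +
    (381845/6834052) * mul_nonneg h.yb2 h.yb3 +
    (179985/3417026) * mul_nonneg h.yb2 h.e3 +
    (381845/6834052) * mul_nonneg h.yb2 h.yb4 +
    (1497411/3417026) * mul_nonneg h.yb2 h.g14 +
    (396219/3417026) * mul_nonneg h.yb2 h.g23 +
    (469343/3417026) * mul_nonneg h.yb2 h.r +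
    (6004399/6834052) * mul_nonneg h.yb2 hy₂ +
    (2442431/6834052) * mul_nonneg h.yb2 hG +
    (198493/3417026) * mul_nonneg h.yb2 hp +
    (577729/3417026) * mul_nonneg h.yb2 hr +
    (159754/1708513) * mul_nonneg h.a2 h.a3 +
    (1143279/6834052) * mul_nonneg h.a2 h.g12 +
    (374288/1708513) * mul_nonneg h.a2 h.g23 +
    (183662/1708513) * mul_nonneg h.a2 h.g24 +
    (1338217/6834052) * mul_nonneg h.a2 h.c34 +
    (530189/3417026) * mul_nonneg h.a2 hG +
    (65937623/82008624) * mul_nonneg h.b3 h.yb3 +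
    (3150359/6834052) * mul_nonneg h.b3 h.a3 +
    (461835/6834052) * mul_nonneg h.b3 h.yb4 +
    (636428/1708513) * mul_nonneg h.b3 h.g13 +
    (2892092/1708513) * mul_nonneg h.b3 h.c24 +
    (414831/1708513) * mul_nonneg h.b3 hp +
    (21733307/82008624) * mul_nonneg h.yb3 h.a3 +
    (2223277/82008624) * mul_nonneg h.yb3 h.c12 +
    (1167941/10251078) * mul_nonneg h.yb3 h.g14 +
    (565793/10251078) * mul_nonneg h.yb3 h.c23 +
    (29603281/41004312) * mul_nonneg h.yb3 h.c24 +
    (257047/10251078) * mul_nonneg h.yb3 hαβ +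
    (10643029/27336208) * mul_nonneg h.yb3 hy₃ +
    (552291/13668104) * mul_nonneg h.yb3 hG +
    (2078227/82008624) * mul_nonneg h.yb3 hp +
    (4888505/27336208) * mul_nonneg h.yb3 hr +
    (461835/6834052) * mul_nonneg h.a3 h.a4 +
    (3697179/6834052) * mul_nonneg h.a3 h.g13 +
    (1549265/20502156) * mul_nonneg h.a3 h.g14 +
    (311471/3417026) * mul_nonneg h.a3 h.g23 +
    (2930153/6834052) * mul_nonneg h.a3 h.c24 +
    (102799/6834052) * mul_nonneg h.e3 h.c34 +
    (1258244/1708513) * mul_nonneg h.b4 h.yb4 +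
    (2351459/3417026) * mul_nonneg h.b4 h.a4 +
    (114656/1708513) * mul_nonneg h.b4 h.c13 +
    (4199053/3417026) * mul_nonneg h.b4 h.c23 +
    (760340/1708513) * mul_nonneg h.b4 h.g24 +
    (699757/6834052) * mul_nonneg h.b4 hαβ +
    (84473/3417026) * mul_nonneg h.b4 hβδ +
    (2075029/3417026) * mul_nonneg h.b4 hG +
    (338037/3417026) * mul_nonneg h.b4 hp +
    (1450921/3417026) * mul_nonneg h.yb4 h.a4 +
    (644461/3417026) * mul_nonneg h.yb4 h.g12 +
    (1997361/6834052) * mul_nonneg h.yb4 h.g23 +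
    (5441395/6834052) * mul_nonneg h.yb4 h.c23 +
    (1155873/6834052) * mul_nonneg h.yb4 hy₄ +
    (532344/1708513) * mul_nonneg h.yb4 hG +
    (170849/6834052) * mul_nonneg h.yb4 hq +
    (879779/6834052) * mul_nonneg h.a4 h.g14 +
    (1302739/3417026) * mul_nonneg h.a4 h.c23 +
    (164304/1708513) * mul_nonneg h.a4 h.g24 +
    (214239/6834052) * mul_nonneg h.a4 h.c24 +
    (168032/1708513) * mul_nonneg h.a4 h.g34 +
    (259205/6834052) * mul_nonneg h.a4 h.c34 +
    (792281/3417026) * mul_nonneg h.a4 hβδ +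
    (689345/3417026) * mul_nonneg h.a4 hG +
    (145316/1708513) * mul_nonneg h.e4 h.c34 +
    (2181895/5125539) * mul_nonneg h.g12 h.g14 +
    (133150/1708513) * mul_nonneg h.g12 hp +
    (56679/3417026) * mul_nonneg h.c12 h.c34 +
    (3462241/6834052) * mul_nonneg h.g13 h.c34 +
    (208111/1708513) * mul_nonneg h.g13 hp +
    (976307/10251078) * mul_nonneg h.g14 h.c14 +
    (70682/5125539) * mul_nonneg h.g14 h.g23 +
    (581677/5125539) * mul_nonneg h.g14 h.c24 +
    (5770463/20502156) * mul_nonneg h.g14 h.c34 +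
    (708139/3417026) * mul_nonneg h.g14 h.r +
    (4440394/5125539) * mul_nonneg h.g14 hβδ +
    (1567087/20502156) * mul_nonneg h.g14 hq +
    (661003/1708513) * mul_nonneg h.g23 h.c23 +
    (14895/1708513) * mul_nonneg h.c23 hp +
    (163289/3417026) * mul_nonneg h.c24 hq +
    (1611839/6834052) * mul_nonneg h.g34 h.c34 +
    (114656/1708513) * mul_nonneg h.c34 hy₃ +
    (425597/3417026) * mul_nonneg h.c34 hq +
    (1392657/6834052) * mul_nonneg h.dA hαβ +
    (1608421/6834052) * mul_nonneg hαβ hp +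
    (53835/1708513) * mul_nonneg hβδ hp +
    (412146/1708513) * mul_nonneg hq hr

lemma ReducedChamber.normSum_le_neg_pos_pos_pos
    (h : ReducedChamber s y₁ y₂ y₃ y₄ b₁ b₂ b₃ b₄ g₁₂ g₁₃ g₁₄ g₂₃ g₂₄ g₃₄)
    (hαβ : 0 ≤ g₁₂ + g₃₄ - g₁₃ - g₂₄)
    (hβδ : 0 ≤ g₁₃ + g₂₄ - g₁₄ - g₂₃)
    (hy₂ : 0 ≤ y₁ - y₂)
    (hy₃ : 0 ≤ y₁ - y₃)
    (hy₄ : 0 ≤ y₁ - y₄)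
    (hG : 0 ≤ g₁₂ + g₁₃ + g₁₄ + g₂₃ + g₂₄ + g₃₄ - s)
    (hp : 0 ≤ -(g₁₃ + g₂₄ - y₃ - y₄ - g₁₂))
    (hq : 0 ≤ g₁₂ + g₂₄ + g₃₄ - s)
    (hr : 0 ≤ y₁ + g₂₃ - y₃ - g₁₂)
    (ht : 0 ≤ b₁ - y₄) :
    normSum y₁ y₂ y₃ y₄ b₁ b₂ b₃ b₄ g₁₂ g₁₃ g₁₄ g₂₃ g₂₄ g₃₄ ≤ s ^ 2 := by
  unfold normSum
  linear_combination
    (442129/1700522) * mul_nonneg h.b1 h.a1 +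
    (526499/850261) * mul_nonneg h.b1 h.a4 +
    (562950/850261) * mul_nonneg h.b1 h.g14 +
    (4658711/5101566) * mul_nonneg h.yb1 h.b2 +
    (1922179/5101566) * mul_nonneg h.yb1 h.yb2 +
    (1633621/5101566) * mul_nonneg h.yb1 h.a2 +
    (402403/1700522) * mul_nonneg h.yb1 h.yb4 +
    (7396591/40812528) * mul_nonneg h.yb1 h.c34 +
    (3467945/5101566) * mul_nonneg h.yb1 ht +
    (1049753/10203132) * mul_nonneg h.a1 h.yb2 +
    (254995/850261) * mul_nonneg h.a1 h.a3 +
    (2492701/40812528) * mul_nonneg h.a1 h.yb4 +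
    (7746995/40812528) * mul_nonneg h.a1 h.a4 +
    (698503/1700522) * mul_nonneg h.a1 h.g12 +
    (11911633/40812528) * mul_nonneg h.a1 h.g13 +
    (5189639/40812528) * mul_nonneg h.a1 h.g14 +
    (11635553/40812528) * mul_nonneg h.a1 h.dA +
    (183887/1700522) * mul_nonneg h.a1 hβδ +
    (109868/2550783) * mul_nonneg h.a1 hy₂ +
    (3164137/40812528) * mul_nonneg h.a1 hy₃ +
    (2339813/13604176) * mul_nonneg h.a1 hy₄ +
    (9436345/40812528) * mul_nonneg h.a1 hp +
    (1156069/10203132) * mul_nonneg h.e1 h.yb2 +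
    (60779/850261) * mul_nonneg h.e1 h.yb3 +
    (157567/3401044) * mul_nonneg h.e1 h.a4 +
    (659091/13604176) * mul_nonneg h.e1 h.c34 +
    (252229/850261) * mul_nonneg h.e1 hr +
    (153617/2550783) * mul_nonneg h.e1 ht +
    (2291752/2550783) * mul_nonneg h.b2 h.yb2 +
    (830313/1700522) * mul_nonneg h.b2 h.a2 +
    (211085/2550783) * mul_nonneg h.b2 h.yb3 +
    (19795/2550783) * mul_nonneg h.b2 h.a3 +
    (3557/850261) * mul_nonneg h.b2 h.c13 +
    (2197079/5101566) * mul_nonneg h.b2 h.g23 +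
    (3277913/5101566) * mul_nonneg h.b2 h.c34 +
    (1492570/2550783) * mul_nonneg h.b2 h.r +
    (3480115/5101566) * mul_nonneg h.b2 hy₂ +
    (1080140/2550783) * mul_nonneg h.b2 hq +
    (1972877/5101566) * mul_nonneg h.yb2 h.a2 +
    (11970/850261) * mul_nonneg h.yb2 h.yb3 +
    (166769/1700522) * mul_nonneg h.yb2 h.c13 +
    (91631/1700522) * mul_nonneg h.yb2 h.c23 +
    (137873/5101566) * mul_nonneg h.yb2 h.c34 +
    (548811/1700522) * mul_nonneg h.yb2 h.r +
    (519284/850261) * mul_nonneg h.yb2 hy₂ +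
    (739817/3401044) * mul_nonneg h.yb2 hG +
    (64990/850261) * mul_nonneg h.a2 h.a3 +
    (584849/5101566) * mul_nonneg h.a2 h.b4 +
    (584849/5101566) * mul_nonneg h.a2 h.a4 +
    (122233/2550783) * mul_nonneg h.a2 h.g13 +
    (567281/2550783) * mul_nonneg h.a2 h.g23 +
    (1135814/2550783) * mul_nonneg h.a2 h.c34 +
    (847688/2550783) * mul_nonneg h.a2 hq +
    (212669/1700522) * mul_nonneg h.a2 hr +
    (815992/850261) * mul_nonneg h.b3 h.yb3 +
    (88733/850261) * mul_nonneg h.b3 h.a3 +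
    (182773/1700522) * mul_nonneg h.b3 h.b4 +
    (68538/850261) * mul_nonneg h.b3 h.g13 +
    (15518/850261) * mul_nonneg h.b3 h.g23 +
    (1735725/1700522) * mul_nonneg h.b3 h.c24 +
    (53020/850261) * mul_nonneg h.b3 h.c34 +
    (26510/850261) * mul_nonneg h.b3 hG +
    (118010/850261) * mul_nonneg h.b3 hr +
    (54464/850261) * mul_nonneg h.yb3 h.a3 +
    (357351/1700522) * mul_nonneg h.yb3 h.b4 +
    (173089/1700522) * mul_nonneg h.yb3 h.yb4 +
    (974197/1700522) * mul_nonneg h.yb3 h.c24 +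
    (1489/1700522) * mul_nonneg h.a3 h.yb4 +
    (544259/850261) * mul_nonneg h.a3 h.g13 +
    (281505/850261) * mul_nonneg h.a3 h.g14 +
    (251538/850261) * mul_nonneg h.a3 h.g23 +
    (228485/850261) * mul_nonneg h.a3 hp +
    (315774/850261) * mul_nonneg h.a3 ht +
    (2504291/3401044) * mul_nonneg h.b4 h.yb4 +
    (911525/1700522) * mul_nonneg h.b4 h.a4 +
    (639771/3401044) * mul_nonneg h.b4 h.e4 +
    (843127/3401044) * mul_nonneg h.b4 h.c23 +
    (977990/850261) * mul_nonneg h.b4 hq +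
    (290315/3401044) * mul_nonneg h.b4 ht +
    (391517/850261) * mul_nonneg h.yb4 h.a4 +
    (720615/13604176) * mul_nonneg h.yb4 h.g14 +
    (525133/1700522) * mul_nonneg h.yb4 h.c23 +
    (103302/850261) * mul_nonneg h.yb4 hy₄ +
    (1089171/1700522) * mul_nonneg h.yb4 hq +
    (2753037/13604176) * mul_nonneg h.a4 h.g14 +
    (15382/850261) * mul_nonneg h.a4 h.g34 +
    (107513/850261) * mul_nonneg h.a4 hβδ +
    (157965/3401044) * mul_nonneg h.a4 hG +
    (185751/1700522) * mul_nonneg h.a4 hp +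
    (354422/850261) * mul_nonneg h.a4 hq +
    (954679/1700522) * mul_nonneg h.g13 h.g24 +
    (348107/850261) * mul_nonneg h.g13 h.dA +
    (624285/1700522) * mul_nonneg h.g13 hy₄ +
    (971369/1700522) * mul_nonneg h.g13 hp +
    (850711/1700522) * mul_nonneg h.g13 ht +
    (5251613/13604176) * mul_nonneg h.g14 h.c14 +
    (356134/850261) * mul_nonneg h.g14 h.g23 +
    (1679571/13604176) * mul_nonneg h.g14 h.c24 +
    (4505711/6802088) * mul_nonneg h.g14 hβδ +
    (5156563/6802088) * mul_nonneg h.g14 hp +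
    (422511/6802088) * mul_nonneg h.g14 hr +
    (1287141/13604176) * mul_nonneg h.c24 h.c34 +
    (1364603/5101566) * mul_nonneg h.c24 h.dA +
    (407186/2550783) * mul_nonneg h.c24 hβδ +
    (5722803/13604176) * mul_nonneg h.g34 h.c34 +
    (673615/40812528) * mul_nonneg h.c34 h.dC +
    (45967/5101566) * mul_nonneg h.c34 hαβ +
    (495719/5101566) * mul_nonneg h.c34 hβδ +
    (170635/13604176) * mul_nonneg h.c34 hy₃ +
    (918392/2550783) * mul_nonneg h.c34 hy₄ +
    (402511/2550783) * mul_nonneg h.dA hp +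
    (468643/2550783) * mul_nonneg h.dA hq +
    (320571/1700522) * mul_nonneg hβδ hp +
    (696335/5101566) * mul_nonneg hβδ hr +
    (160427/1700522) * mul_nonneg hp hr

lemma ReducedChamber.normSum_le_neg_pos_pos_neg
    (h : ReducedChamber s y₁ y₂ y₃ y₄ b₁ b₂ b₃ b₄ g₁₂ g₁₃ g₁₄ g₂₃ g₂₄ g₃₄)
    (hαβ : 0 ≤ g₁₂ + g₃₄ - g₁₃ - g₂₄)
    (hβδ : 0 ≤ g₁₃ + g₂₄ - g₁₄ - g₂₃)
    (hy₂ : 0 ≤ y₁ - y₂)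
    (hy₃ : 0 ≤ y₁ - y₃)
    (hy₄ : 0 ≤ y₁ - y₄)
    (hp : 0 ≤ -(g₁₃ + g₂₄ - y₃ - y₄ - g₁₂))
    (hq : 0 ≤ g₁₂ + g₂₄ + g₃₄ - s)
    (hr : 0 ≤ y₁ + g₂₃ - y₃ - g₁₂)
    (ht : 0 ≤ -(b₁ - y₄)) :
    normSum y₁ y₂ y₃ y₄ b₁ b₂ b₃ b₄ g₁₂ g₁₃ g₁₄ g₂₃ g₂₄ g₃₄ ≤ s ^ 2 := by
  unfold normSum
  linear_combination
    (13/54) * mul_nonneg h.b1 h.yb1 +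
    (1/54) * mul_nonneg h.b1 h.e1 +
    (2/27) * mul_nonneg h.b1 h.b2 +
    (19/54) * mul_nonneg h.b1 h.yb2 +
    (16/27) * mul_nonneg h.b1 h.b3 +
    (4/27) * mul_nonneg h.b1 h.a3 +
    (257/378) * mul_nonneg h.b1 h.b4 +
    (44/81) * mul_nonneg h.b1 h.a4 +
    (8/27) * mul_nonneg h.b1 h.g14 +
    (7/54) * mul_nonneg h.b1 h.c23 +
    (7/54) * mul_nonneg h.b1 h.c34 +
    (4/27) * mul_nonneg h.b1 hq +
    (8/9) * mul_nonneg h.b1 ht +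
    (4/81) * mul_nonneg h.yb1 h.a1 +
    (5/18) * mul_nonneg h.a1 h.yb2 +
    (20/27) * mul_nonneg h.a1 h.b3 +
    (8/27) * mul_nonneg h.a1 h.a3 +
    (323/1134) * mul_nonneg h.a1 h.b4 +
    (4/27) * mul_nonneg h.a1 h.a4 +
    (2/9) * mul_nonneg h.a1 h.g12 +
    (91/162) * mul_nonneg h.a1 h.g13 +
    (4/81) * mul_nonneg h.a1 h.g14 +
    (1/18) * mul_nonneg h.a1 h.c34 +
    (31/162) * mul_nonneg h.a1 h.dA +
    (19/162) * mul_nonneg h.a1 hy₃ +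
    (43/162) * mul_nonneg h.a1 hp +
    (8/81) * mul_nonneg h.a1 ht +
    (5/18) * mul_nonneg h.b2 h.yb2 +
    (8/9) * mul_nonneg h.b2 h.a2 +
    (1/9) * mul_nonneg h.b2 h.yb3 +
    (1/18) * mul_nonneg h.b2 h.a3 +
    (5/18) * mul_nonneg h.b2 h.b4 +
    (79/162) * mul_nonneg h.b2 h.a4 +
    (2/9) * mul_nonneg h.b2 h.c13 +
    (2/9) * mul_nonneg h.b2 h.g23 +
    (4/3) * mul_nonneg h.b2 h.c34 +
    2 * mul_nonneg h.b2 hq +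
    (8/9) * mul_nonneg h.b2 hr +
    (1/6) * mul_nonneg h.yb2 h.a2 +
    (1/12) * mul_nonneg h.yb2 h.yb3 +
    (1/6) * mul_nonneg h.yb2 h.yb4 +
    (2/3) * mul_nonneg h.yb2 h.r +
    (5/6) * mul_nonneg h.yb2 hy₂ +
    (1/3) * mul_nonneg h.yb2 hq +
    (1/12) * mul_nonneg h.a2 h.yb3 +
    (10/63) * mul_nonneg h.a2 h.b4 +
    (17/81) * mul_nonneg h.a2 h.a4 +
    (2/3) * mul_nonneg h.a2 h.c34 +
    (2/3) * mul_nonneg h.a2 hq +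
    (1/3) * mul_nonneg h.a2 hr +
    (1/126) * mul_nonneg h.e2 h.b4 +
    (5/9) * mul_nonneg h.b3 h.yb3 +
    (5/6) * mul_nonneg h.b3 h.a3 +
    (10/3) * mul_nonneg h.b3 h.g13 +
    (8/27) * mul_nonneg h.b3 hr +
    (7/18) * mul_nonneg h.yb3 h.a3 +
    1 * mul_nonneg h.yb3 h.g13 +
    (13/36) * mul_nonneg h.yb3 h.c24 +
    (4/9) * mul_nonneg h.yb3 h.dA +
    (4/9) * mul_nonneg h.yb3 hβδ +
    (5/36) * mul_nonneg h.yb3 hr +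
    1 * mul_nonneg h.a3 h.g13 +
    (1/6) * mul_nonneg h.a3 h.g23 +
    (2/27) * mul_nonneg h.a3 hr +
    (151/189) * mul_nonneg h.b4 h.yb4 +
    (293/378) * mul_nonneg h.b4 h.a4 +
    (130/189) * mul_nonneg h.b4 h.g14 +
    (1/189) * mul_nonneg h.b4 h.c23 +
    (46/189) * mul_nonneg h.b4 hβδ +
    (1/54) * mul_nonneg h.b4 hy₄ +
    (17/126) * mul_nonneg h.b4 hq +
    (31/54) * mul_nonneg h.yb4 h.a4 +
    (1/18) * mul_nonneg h.yb4 h.r +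
    (8/27) * mul_nonneg h.a4 h.g14 +
    (7/54) * mul_nonneg h.a4 h.g24 +
    (11/162) * mul_nonneg h.a4 h.c34 +
    (1/162) * mul_nonneg h.a4 h.dA +
    (7/162) * mul_nonneg h.a4 h.dC +
    (25/162) * mul_nonneg h.a4 hβδ +
    (1/18) * mul_nonneg h.a4 hp +
    (19/54) * mul_nonneg h.c12 h.c34 +
    (2/3) * mul_nonneg h.g13 h.g23 +
    (1/18) * mul_nonneg h.g14 h.c14 +
    (11/18) * mul_nonneg h.g14 h.c24 +
    (2/3) * mul_nonneg h.g14 h.dA +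
    (17/18) * mul_nonneg h.g14 hβδ +
    (17/18) * mul_nonneg h.g14 hp +
    (7/18) * mul_nonneg h.g14 hr +
    (7/54) * mul_nonneg h.c23 hp +
    (5/18) * mul_nonneg h.c23 hr +
    (11/54) * mul_nonneg h.c24 h.dA +
    (17/54) * mul_nonneg h.c24 hβδ +
    (1/3) * mul_nonneg h.c24 hy₄ +
    (1/27) * mul_nonneg h.c34 hαβ +
    (1/9) * mul_nonneg h.c34 hy₄ +
    (2/3) * mul_nonneg h.c34 hq +
    (1/6) * mul_nonneg h.c34 hr +
    (5/54) * mul_nonneg h.dA h.r +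
    (10/27) * mul_nonneg h.dA hαβ +
    (5/27) * mul_nonneg h.r hp +
    (4/27) * mul_nonneg hβδ hr

lemma ReducedChamber.normSum_le_neg_pos_neg_pos
    (h : ReducedChamber s y₁ y₂ y₃ y₄ b₁ b₂ b₃ b₄ g₁₂ g₁₃ g₁₄ g₂₃ g₂₄ g₃₄)
    (hy₃ : 0 ≤ y₁ - y₃)
    (hp : 0 ≤ -(g₁₃ + g₂₄ - y₃ - y₄ - g₁₂))
    (hq : 0 ≤ g₁₂ + g₂₄ + g₃₄ - s)
    (hr : 0 ≤ -(y₁ + g₂₃ - y₃ - g₁₂))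
    (ht : 0 ≤ y₁ + g₂₄ - y₄ - g₁₂) :
    normSum y₁ y₂ y₃ y₄ b₁ b₂ b₃ b₄ g₁₂ g₁₃ g₁₄ g₂₃ g₂₄ g₃₄ ≤ s ^ 2 := by
  unfold normSum
  linear_combination
    1 * mul_nonneg h.b1 h.yb1 +
    1 * mul_nonneg h.b1 h.a1 +
    2 * mul_nonneg h.b1 h.g14 +
    1 * mul_nonneg h.yb1 h.a1 +
    1 * mul_nonneg h.yb1 h.g14 +
    1 * mul_nonneg h.a1 h.g14 +
    1 * mul_nonneg h.b2 h.yb2 +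
    1 * mul_nonneg h.b2 h.a2 +
    2 * mul_nonneg h.b2 h.c34 +
    1 * mul_nonneg h.yb2 h.a2 +
    1 * mul_nonneg h.yb2 h.c34 +
    1 * mul_nonneg h.a2 h.c34 +
    1 * mul_nonneg h.b3 h.yb3 +
    1 * mul_nonneg h.b3 h.a3 +
    1 * mul_nonneg h.yb3 h.a3 +
    1 * mul_nonneg h.b4 h.yb4 +
    1 * mul_nonneg h.b4 h.a4 +
    2 * mul_nonneg h.b4 h.c12 +
    1 * mul_nonneg h.yb4 h.a4 +
    1 * mul_nonneg h.yb4 h.c12 +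
    1 * mul_nonneg h.a4 h.c12 +
    1 * mul_nonneg h.g13 h.g14 +
    1 * mul_nonneg h.g13 hp +
    1 * mul_nonneg h.g13 ht +
    1 * mul_nonneg h.g14 hy₃ +
    1 * mul_nonneg h.g23 h.dA +
    1 * mul_nonneg h.g23 hr +
    1 * mul_nonneg h.g24 h.c24 +
    1 * mul_nonneg h.dA hq

lemma ReducedChamber.normSum_le_neg_pos_neg_neg
    (h : ReducedChamber s y₁ y₂ y₃ y₄ b₁ b₂ b₃ b₄ g₁₂ g₁₃ g₁₄ g₂₃ g₂₄ g₃₄)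
    (hβδ : 0 ≤ g₁₃ + g₂₄ - g₁₄ - g₂₃)
    (hy₃ : 0 ≤ y₁ - y₃)
    (hy₄ : 0 ≤ y₁ - y₄)
    (hG : 0 ≤ g₁₂ + g₁₃ + g₁₄ + g₂₃ + g₂₄ + g₃₄ - s)
    (hp : 0 ≤ -(g₁₃ + g₂₄ - y₃ - y₄ - g₁₂))
    (hq : 0 ≤ g₁₂ + g₂₄ + g₃₄ - s)
    (hr : 0 ≤ -(y₁ + g₂₃ - y₃ - g₁₂))
    (ht : 0 ≤ -(y₁ + g₂₄ - y₄ - g₁₂)) :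
    normSum y₁ y₂ y₃ y₄ b₁ b₂ b₃ b₄ g₁₂ g₁₃ g₁₄ g₂₃ g₂₄ g₃₄ ≤ s ^ 2 := by
  unfold normSum
  linear_combination
    1 * mul_nonneg h.b1 h.yb1 +
    1 * mul_nonneg h.b1 h.a1 +
    (3/7) * mul_nonneg h.b1 h.a3 +
    (2/7) * mul_nonneg h.b1 h.a4 +
    (6/7) * mul_nonneg h.b1 h.g13 +
    (2/7) * mul_nonneg h.b1 h.g14 +
    1 * mul_nonneg h.yb1 h.a1 +
    (1/7) * mul_nonneg h.yb1 h.g13 +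
    (3/7) * mul_nonneg h.a1 h.a3 +
    (2/7) * mul_nonneg h.a1 h.a4 +
    (5/7) * mul_nonneg h.a1 h.g13 +
    (2/7) * mul_nonneg h.a1 h.g14 +
    1 * mul_nonneg h.b2 h.yb2 +
    1 * mul_nonneg h.b2 h.a2 +
    2 * mul_nonneg h.b2 h.c34 +
    1 * mul_nonneg h.yb2 h.a2 +
    1 * mul_nonneg h.yb2 h.c34 +
    1 * mul_nonneg h.a2 h.c34 +
    1 * mul_nonneg h.b3 h.yb3 +
    (4/7) * mul_nonneg h.b3 h.a3 +
    (4/7) * mul_nonneg h.b3 h.c12 +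
    (4/7) * mul_nonneg h.yb3 h.a3 +
    (1/7) * mul_nonneg h.yb3 h.c12 +
    (3/7) * mul_nonneg h.yb3 h.g14 +
    (3/7) * mul_nonneg h.a3 h.g13 +
    (3/7) * mul_nonneg h.a3 hy₄ +
    1 * mul_nonneg h.b4 h.yb4 +
    (5/7) * mul_nonneg h.b4 h.a4 +
    (2/7) * mul_nonneg h.b4 h.c12 +
    (8/7) * mul_nonneg h.b4 h.g14 +
    (5/7) * mul_nonneg h.yb4 h.a4 +
    (2/7) * mul_nonneg h.yb4 h.g13 +
    (6/7) * mul_nonneg h.yb4 h.g14 +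
    (4/7) * mul_nonneg h.a4 h.g14 +
    (2/7) * mul_nonneg h.a4 hy₃ +
    (2/7) * mul_nonneg h.c12 hp +
    (1/7) * mul_nonneg h.g13 h.dA +
    (11/7) * mul_nonneg h.g13 hy₄ +
    (2/7) * mul_nonneg h.g13 hp +
    (3/7) * mul_nonneg h.g14 hβδ +
    (9/7) * mul_nonneg h.g14 hy₃ +
    (1/7) * mul_nonneg h.g14 hp +
    (3/7) * mul_nonneg h.g23 h.c23 +
    (6/7) * mul_nonneg h.g23 h.dA +
    (4/7) * mul_nonneg h.g23 hr +
    (4/7) * mul_nonneg h.g24 h.c24 +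
    (1/7) * mul_nonneg h.g24 ht +
    (2/7) * mul_nonneg h.c24 h.dA +
    (1/7) * mul_nonneg h.dA hG +
    (6/7) * mul_nonneg h.dA hq +
    (2/7) * mul_nonneg hq ht

lemma ReducedChamber.normSum_le_neg_neg_pos_pos
    (h : ReducedChamber s y₁ y₂ y₃ y₄ b₁ b₂ b₃ b₄ g₁₂ g₁₃ g₁₄ g₂₃ g₂₄ g₃₄)
    (hαβ : 0 ≤ g₁₂ + g₃₄ - g₁₃ - g₂₄)
    (hβδ : 0 ≤ g₁₃ + g₂₄ - g₁₄ - g₂₃)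
    (hy₂ : 0 ≤ y₁ - y₂)
    (hy₃ : 0 ≤ y₁ - y₃)
    (hy₄ : 0 ≤ y₁ - y₄)
    (hG : 0 ≤ g₁₂ + g₁₃ + g₁₄ + g₂₃ + g₂₄ + g₃₄ - s)
    (hp : 0 ≤ -(g₁₃ + g₂₄ - y₃ - y₄ - g₁₂))
    (hq : 0 ≤ -(g₁₂ + g₂₄ + g₃₄ - s))
    (hr : 0 ≤ 2 * g₂₄ + y₁ + y₃ - s)
    (ht : 0 ≤ s + y₃ + y₄ + g₁₂ - y₁ - b₁ - g₂₃ - g₂₄ - g₃₄) :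
    normSum y₁ y₂ y₃ y₄ b₁ b₂ b₃ b₄ g₁₂ g₁₃ g₁₄ g₂₃ g₂₄ g₃₄ ≤ s ^ 2 := by
  unfold normSum
  linear_combination
    (118877819/114903477) * mul_nonneg h.b1 h.yb1 +
    (8150476/63835265) * mul_nonneg h.b1 h.a1 +
    (25164523/574517385) * mul_nonneg h.b1 h.yb2 +
    (26968316/191505795) * mul_nonneg h.b1 h.a3 +
    (97784153/574517385) * mul_nonneg h.b1 h.a4 +
    (59319103/191505795) * mul_nonneg h.b1 h.c24 +
    (5357662/44193645) * mul_nonneg h.b1 h.r +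
    (93689372/574517385) * mul_nonneg h.b1 hG +
    (1655852/63835265) * mul_nonneg h.a1 h.a2 +
    (2052371/114903477) * mul_nonneg h.a1 h.e2 +
    (66488497/574517385) * mul_nonneg h.a1 h.yb3 +
    (14416451/574517385) * mul_nonneg h.a1 h.e3 +
    (4640813/574517385) * mul_nonneg h.a1 h.b4 +
    (102424966/574517385) * mul_nonneg h.a1 h.a4 +
    (8161268/191505795) * mul_nonneg h.a1 h.g12 +
    (4393423/114903477) * mul_nonneg h.a1 h.g14 +
    (77995097/574517385) * mul_nonneg h.a1 h.dB +
    (3864112/114903477) * mul_nonneg h.a1 hy₂ +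
    (75613444/114903477) * mul_nonneg h.a1 hy₃ +
    (62492104/574517385) * mul_nonneg h.a1 hy₄ +
    (40304362/191505795) * mul_nonneg h.a1 hG +
    (93225994/574517385) * mul_nonneg h.a1 ht +
    (113353603/114903477) * mul_nonneg h.b2 h.yb2 +
    (515705042/574517385) * mul_nonneg h.b2 h.a2 +
    (15108883/574517385) * mul_nonneg h.b2 h.yb3 +
    (16398856/63835265) * mul_nonneg h.b2 h.b4 +
    (12726999/63835265) * mul_nonneg h.b2 h.yb4 +
    (35199166/574517385) * mul_nonneg h.b2 h.c14 +
    (40204556/114903477) * mul_nonneg h.b2 h.g23 +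
    (67627428/63835265) * mul_nonneg h.b2 h.c34 +
    (7028876/44193645) * mul_nonneg h.b2 h.r +
    (507955672/574517385) * mul_nonneg h.yb2 h.a2 +
    (125422/12767053) * mul_nonneg h.yb2 h.yb3 +
    (492043/38301159) * mul_nonneg h.yb2 h.e3 +
    (1880197/12767053) * mul_nonneg h.yb2 h.b4 +
    (5729128/63835265) * mul_nonneg h.yb2 h.yb4 +
    (4183571/63835265) * mul_nonneg h.yb2 h.c14 +
    (154054283/574517385) * mul_nonneg h.yb2 h.g23 +
    (31538323/574517385) * mul_nonneg h.yb2 h.c24 +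
    (23926439/44193645) * mul_nonneg h.yb2 h.c34 +
    (26664227/574517385) * mul_nonneg h.yb2 h.r +
    (11666047/191505795) * mul_nonneg h.yb2 hG +
    (13246657/574517385) * mul_nonneg h.a2 h.b3 +
    (3066181/114903477) * mul_nonneg h.a2 h.a3 +
    (6517297/191505795) * mul_nonneg h.a2 h.g23 +
    (307068038/574517385) * mul_nonneg h.a2 h.c34 +
    (192258/63835265) * mul_nonneg h.a2 h.r +
    (3400781/191505795) * mul_nonneg h.a2 hq +
    (70820/12767053) * mul_nonneg h.a2 hr +
    (1832429/191505795) * mul_nonneg h.e2 h.g13 +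
    (572433137/574517385) * mul_nonneg h.b3 h.yb3 +
    (37206352/63835265) * mul_nonneg h.b3 h.a3 +
    (3671857/63835265) * mul_nonneg h.b3 h.yb4 +
    (131663939/574517385) * mul_nonneg h.b3 h.c24 +
    (7343714/63835265) * mul_nonneg h.b3 h.r +
    (13272868/191505795) * mul_nonneg h.b3 hy₃ +
    (66554584/114903477) * mul_nonneg h.yb3 h.a3 +
    (37983887/191505795) * mul_nonneg h.yb3 h.g14 +
    (77033813/574517385) * mul_nonneg h.yb3 h.c34 +
    (2257297/191505795) * mul_nonneg h.yb3 hq +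
    (3671857/63835265) * mul_nonneg h.a3 h.a4 +
    (56193929/191505795) * mul_nonneg h.a3 h.g13 +
    (8335694/191505795) * mul_nonneg h.a3 h.g34 +
    (6904699/44193645) * mul_nonneg h.a3 hαβ +
    (543630104/574517385) * mul_nonneg h.b4 h.yb4 +
    (49538439/63835265) * mul_nonneg h.b4 h.a4 +
    (187050556/574517385) * mul_nonneg h.b4 h.c12 +
    (1051822/44193645) * mul_nonneg h.b4 h.c23 +
    (11934992/114903477) * mul_nonneg h.b4 h.r +
    (3671857/63835265) * mul_nonneg h.b4 hβδ +
    (696764/574517385) * mul_nonneg h.b4 hG +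
    (82991734/114903477) * mul_nonneg h.yb4 h.a4 +
    (3660562/114903477) * mul_nonneg h.yb4 h.g14 +
    (15339932/574517385) * mul_nonneg h.yb4 h.g23 +
    (44560967/574517385) * mul_nonneg h.yb4 h.c23 +
    (26628247/574517385) * mul_nonneg h.yb4 h.r +
    (4462639/191505795) * mul_nonneg h.yb4 hq +
    (18285167/114903477) * mul_nonneg h.a4 h.c12 +
    (9888682/38301159) * mul_nonneg h.a4 h.g13 +
    (10624969/63835265) * mul_nonneg h.a4 hy₃ +
    (16244113/574517385) * mul_nonneg h.a4 hG +
    (83333/38301159) * mul_nonneg h.c12 h.c24 +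
    (14214901/63835265) * mul_nonneg h.c12 hβδ +
    (1701446/574517385) * mul_nonneg h.c12 hy₃ +
    (28017551/191505795) * mul_nonneg h.c12 hp +
    (95742683/574517385) * mul_nonneg h.c12 ht +
    (131515751/191505795) * mul_nonneg h.g13 hαβ +
    (78377372/574517385) * mul_nonneg h.g13 hy₂ +
    (22805816/191505795) * mul_nonneg h.g13 hy₃ +
    (7134401/574517385) * mul_nonneg h.g13 hp +
    (225430004/574517385) * mul_nonneg h.g13 hr +
    (48776314/574517385) * mul_nonneg h.g14 h.c14 +
    (145032124/114903477) * mul_nonneg h.g14 h.g23 +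
    (50682532/191505795) * mul_nonneg h.g14 h.c24 +
    (149077501/574517385) * mul_nonneg h.g14 hαβ +
    (88411712/114903477) * mul_nonneg h.g14 hβδ +
    (577752592/574517385) * mul_nonneg h.g14 hy₃ +
    (111612544/191505795) * mul_nonneg h.g23 h.c23 +
    (20421922/63835265) * mul_nonneg h.g23 hβδ +
    (105757/114903477) * mul_nonneg h.c23 h.c24 +
    (1207637/63835265) * mul_nonneg h.c23 hy₃ +
    (997571/63835265) * mul_nonneg h.c24 h.c34 +
    (26990711/191505795) * mul_nonneg h.c24 h.r +
    (20177903/574517385) * mul_nonneg h.c24 hq +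
    (216673261/574517385) * mul_nonneg h.c24 hr +
    (34681622/114903477) * mul_nonneg h.g34 h.c34 +
    (3386404/574517385) * mul_nonneg h.r hαβ +
    (14325874/574517385) * mul_nonneg h.r hβδ +
    (23600186/191505795) * mul_nonneg h.r hy₃ +
    (1027682/4910405) * mul_nonneg h.r hq +
    (110080526/574517385) * mul_nonneg hαβ hq +
    (51661469/574517385) * mul_nonneg hβδ hG +
    (10088932/574517385) * mul_nonneg hβδ hq +
    (2558/38649) * mul_nonneg hy₃ hG +
    (107523079/574517385) * mul_nonneg hG hp +
    (38612636/114903477) * mul_nonneg hG hq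

lemma ReducedChamber.normSum_le_neg_neg_pos_neg
    (h : ReducedChamber s y₁ y₂ y₃ y₄ b₁ b₂ b₃ b₄ g₁₂ g₁₃ g₁₄ g₂₃ g₂₄ g₃₄)
    (hαβ : 0 ≤ g₁₂ + g₃₄ - g₁₃ - g₂₄)
    (hβδ : 0 ≤ g₁₃ + g₂₄ - g₁₄ - g₂₃)
    (hy₂ : 0 ≤ y₁ - y₂)
    (hy₃ : 0 ≤ y₁ - y₃)
    (hy₄ : 0 ≤ y₁ - y₄)
    (hG : 0 ≤ g₁₂ + g₁₃ + g₁₄ + g₂₃ + g₂₄ + g₃₄ - s)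
    (hp : 0 ≤ -(g₁₃ + g₂₄ - y₃ - y₄ - g₁₂))
    (hq : 0 ≤ -(g₁₂ + g₂₄ + g₃₄ - s))
    (hr : 0 ≤ 2 * g₂₄ + y₁ + y₃ - s)
    (ht : 0 ≤ -(s + y₃ + y₄ + g₁₂ - y₁ - b₁ - g₂₃ - g₂₄ - g₃₄)) :
    normSum y₁ y₂ y₃ y₄ b₁ b₂ b₃ b₄ g₁₂ g₁₃ g₁₄ g₂₃ g₂₄ g₃₄ ≤ s ^ 2 := by
  unfold normSum
  linear_combination
    (2754965314/3325283475) * mul_nonneg h.b1 h.yb1 +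
    (778676567/5542139125) * mul_nonneg h.b1 h.a1 +
    (7044842/221685565) * mul_nonneg h.b1 h.a4 +
    (843284438/9975850425) * mul_nonneg h.b1 h.c24 +
    (26377754/665056695) * mul_nonneg h.yb1 h.b2 +
    (91996478/1108427825) * mul_nonneg h.yb1 h.b3 +
    (1852561/44337113) * mul_nonneg h.yb1 h.b4 +
    (3361263/1108427825) * mul_nonneg h.yb1 h.g14 +
    (814570867/3325283475) * mul_nonneg h.yb1 h.c23 +
    (163891243/3325283475) * mul_nonneg h.yb1 hp +
    (1012285661/16626417375) * mul_nonneg h.a1 h.e1 +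
    (29460663/1108427825) * mul_nonneg h.a1 h.a2 +
    (3171141208/49879252125) * mul_nonneg h.a1 h.yb3 +
    (35338382/49879252125) * mul_nonneg h.a1 h.a3 +
    (40695187/1108427825) * mul_nonneg h.a1 h.a4 +
    (12922566407/49879252125) * mul_nonneg h.a1 h.g12 +
    (1064659292/9975850425) * mul_nonneg h.a1 h.g14 +
    (340777678/1995170085) * mul_nonneg h.a1 hβδ +
    (497598166/3325283475) * mul_nonneg h.a1 hy₂ +
    (15194592472/49879252125) * mul_nonneg h.a1 hy₃ +
    (1966735193/49879252125) * mul_nonneg h.a1 hy₄ +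
    (9743754623/49879252125) * mul_nonneg h.a1 hp +
    (12734078/48662685) * mul_nonneg h.a1 hq +
    (3470284553/49879252125) * mul_nonneg h.a1 hr +
    (1061141/81104475) * mul_nonneg h.e1 h.yb2 +
    (20741376/1108427825) * mul_nonneg h.e1 h.a3 +
    (110554934/1108427825) * mul_nonneg h.e1 h.b4 +
    (151397982/1108427825) * mul_nonneg h.e1 h.yb4 +
    (390719133/1108427825) * mul_nonneg h.e1 h.g23 +
    (1813732/133011339) * mul_nonneg h.e1 hβδ +
    (58951307/1108427825) * mul_nonneg h.e1 hy₃ +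
    (101856451/1108427825) * mul_nonneg h.e1 ht +
    (9226557721/9975850425) * mul_nonneg h.b2 h.yb2 +
    (2474998871/3325283475) * mul_nonneg h.b2 h.a2 +
    (26033584/221685565) * mul_nonneg h.b2 h.yb3 +
    (88099956/1108427825) * mul_nonneg h.b2 h.a4 +
    (553747592/3325283475) * mul_nonneg h.b2 h.g12 +
    (128751524/221685565) * mul_nonneg h.b2 h.c34 +
    (2418965042/3325283475) * mul_nonneg h.b2 h.r +
    (7668708/1108427825) * mul_nonneg h.b2 hG +
    (621681914/3325283475) * mul_nonneg h.b2 hp +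
    (6675703909/9975850425) * mul_nonneg h.yb2 h.a2 +
    (13016792/221685565) * mul_nonneg h.yb2 h.yb3 +
    (41785931/1108427825) * mul_nonneg h.yb2 h.yb4 +
    (315024914/9975850425) * mul_nonneg h.yb2 h.c13 +
    (1204528001/9975850425) * mul_nonneg h.yb2 h.c23 +
    (3238816024/9975850425) * mul_nonneg h.yb2 h.c34 +
    (668400907/1995170085) * mul_nonneg h.yb2 h.r +
    (1870630501/9975850425) * mul_nonneg h.yb2 hαβ +
    (3079708/81104475) * mul_nonneg h.yb2 hy₂ +
    (137836628/1108427825) * mul_nonneg h.yb2 hG +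
    (13016792/221685565) * mul_nonneg h.a2 h.a3 +
    (142493188/1108427825) * mul_nonneg h.a2 h.b4 +
    (188807213/1108427825) * mul_nonneg h.a2 h.a4 +
    (79112979/1108427825) * mul_nonneg h.a2 h.c24 +
    (441611449/1108427825) * mul_nonneg h.a2 h.c34 +
    (166316758/9975850425) * mul_nonneg h.e2 h.c24 +
    (1087686449/1108427825) * mul_nonneg h.b3 h.yb3 +
    (14077813/27034825) * mul_nonneg h.b3 h.a3 +
    (42518846/1108427825) * mul_nonneg h.b3 h.a4 +
    (82965504/1108427825) * mul_nonneg h.b3 h.g13 +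
    (347244536/1108427825) * mul_nonneg h.b3 h.c24 +
    (71255102/1108427825) * mul_nonneg h.b3 hβδ +
    (556448957/1108427825) * mul_nonneg h.yb3 h.a3 +
    (42518846/1108427825) * mul_nonneg h.a3 h.a4 +
    (367985912/1108427825) * mul_nonneg h.a3 h.g13 +
    (157080438/1108427825) * mul_nonneg h.a3 h.g23 +
    (32650316/221685565) * mul_nonneg h.a3 h.c23 +
    (26912518/1108427825) * mul_nonneg h.a3 h.g34 +
    (32650316/221685565) * mul_nonneg h.a3 hp +
    (26912518/1108427825) * mul_nonneg h.a3 hq +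
    (1073644003/1108427825) * mul_nonneg h.b4 h.yb4 +
    (181384043/221685565) * mul_nonneg h.b4 h.a4 +
    (635423994/1108427825) * mul_nonneg h.b4 h.c23 +
    (4528094/1108427825) * mul_nonneg h.b4 h.r +
    (19070934/1108427825) * mul_nonneg h.b4 hβδ +
    (872136393/1108427825) * mul_nonneg h.yb4 h.a4 +
    (7449152/27034825) * mul_nonneg h.yb4 h.c23 +
    (48578072/1108427825) * mul_nonneg h.yb4 hG +
    (206244208/1108427825) * mul_nonneg h.a4 h.c23 +
    (440388/1108427825) * mul_nonneg h.a4 h.c24 +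
    (61737641/1108427825) * mul_nonneg h.a4 hβδ +
    (7686228/221685565) * mul_nonneg h.a4 hp +
    (30400394/1108427825) * mul_nonneg h.e4 h.g13 +
    (25491522/1108427825) * mul_nonneg h.g12 h.dA +
    (252477832/3325283475) * mul_nonneg h.g12 hβδ +
    (527602312/1108427825) * mul_nonneg h.g12 hq +
    (225204927/1108427825) * mul_nonneg h.g12 ht +
    (375598871/1108427825) * mul_nonneg h.g13 h.c13 +
    (145245088/1108427825) * mul_nonneg h.g13 h.c23 +
    (266517408/1108427825) * mul_nonneg h.g13 hp +
    (270021344/1108427825) * mul_nonneg h.g13 hr +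
    (48593447/1108427825) * mul_nonneg h.c13 h.c24 +
    (723470601/1108427825) * mul_nonneg h.g14 h.c14 +
    (25782944/1108427825) * mul_nonneg h.g14 h.g23 +
    (1213124126/3325283475) * mul_nonneg h.g14 hβδ +
    (462374772/1108427825) * mul_nonneg h.g14 hp +
    (454120771/1108427825) * mul_nonneg h.g23 h.c23 +
    (344404748/3325283475) * mul_nonneg h.g23 hβδ +
    (26828001/221685565) * mul_nonneg h.c23 h.c24 +
    (224875963/1108427825) * mul_nonneg h.c23 h.c34 +
    (2568753/1108427825) * mul_nonneg h.c23 hp +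
    (92483176/9975850425) * mul_nonneg h.c24 h.c34 +
    (368932498/9975850425) * mul_nonneg h.c24 h.dA +
    (33531523/1108427825) * mul_nonneg h.c24 hq +
    (60031002/221685565) * mul_nonneg h.c24 hr +
    (7548237/1108427825) * mul_nonneg h.c24 ht +
    (6416409/44337113) * mul_nonneg h.g34 h.c34 +
    (325581693/1108427825) * mul_nonneg h.c34 hαβ +
    (115994713/3325283475) * mul_nonneg h.c34 hβδ +
    (180824458/1108427825) * mul_nonneg h.c34 ht +
    (488505412/3325283475) * mul_nonneg h.r hβδ +
    (19224103/221685565) * mul_nonneg h.r hp +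
    (462122396/3325283475) * mul_nonneg hβδ hG +
    (468427042/3325283475) * mul_nonneg hβδ hp +
    (257067517/1108427825) * mul_nonneg hG hp +
    (80603044/221685565) * mul_nonneg hG hq

lemma ReducedChamber.normSum_le_neg_neg_neg_pos
    (h : ReducedChamber s y₁ y₂ y₃ y₄ b₁ b₂ b₃ b₄ g₁₂ g₁₃ g₁₄ g₂₃ g₂₄ g₃₄)
    (hαβ : 0 ≤ g₁₂ + g₃₄ - g₁₃ - g₂₄)
    (hβδ : 0 ≤ g₁₃ + g₂₄ - g₁₄ - g₂₃)
    (hy₂ : 0 ≤ y₁ - y₂)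
    (hy₃ : 0 ≤ y₁ - y₃)
    (hy₄ : 0 ≤ y₁ - y₄)
    (hG : 0 ≤ g₁₂ + g₁₃ + g₁₄ + g₂₃ + g₂₄ + g₃₄ - s)
    (hq : 0 ≤ -(g₁₂ + g₂₄ + g₃₄ - s))
    (hr : 0 ≤ -(2 * g₂₄ + y₁ + y₃ - s))
    (ht : 0 ≤ 2 * g₁₂ + y₃ + y₄ - s) :
    normSum y₁ y₂ y₃ y₄ b₁ b₂ b₃ b₄ g₁₂ g₁₃ g₁₄ g₂₃ g₂₄ g₃₄ ≤ s ^ 2 := by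
  unfold normSum
  linear_combination
    1 * mul_nonneg h.b1 h.yb1 +
    (155/2637) * mul_nonneg h.b1 h.a1 +
    (55/293) * mul_nonneg h.b1 h.yb2 +
    (155/879) * mul_nonneg h.b1 h.a3 +
    (40/293) * mul_nonneg h.b1 h.a4 +
    (256/879) * mul_nonneg h.b1 h.c12 +
    (478/879) * mul_nonneg h.b1 h.g13 +
    (26/293) * mul_nonneg h.b1 h.g24 +
    (212/879) * mul_nonneg h.b1 h.c34 +
    (100/879) * mul_nonneg h.b1 hβδ +
    (164/879) * mul_nonneg h.b1 hG +
    (155/2637) * mul_nonneg h.a1 h.e1 +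
    (59/879) * mul_nonneg h.a1 h.yb2 +
    (106/879) * mul_nonneg h.a1 h.e2 +
    (310/2637) * mul_nonneg h.a1 h.yb3 +
    (5/1758) * mul_nonneg h.a1 h.a3 +
    (295/5274) * mul_nonneg h.a1 h.e3 +
    (40/293) * mul_nonneg h.a1 h.a4 +
    (758/2637) * mul_nonneg h.a1 h.g13 +
    (256/879) * mul_nonneg h.a1 h.g14 +
    (1475/5274) * mul_nonneg h.a1 h.dA +
    (1439/5274) * mul_nonneg h.a1 hβδ +
    (1388/2637) * mul_nonneg h.a1 hy₃ +
    (256/879) * mul_nonneg h.a1 hy₄ +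
    (203/879) * mul_nonneg h.a1 hG +
    (238/293) * mul_nonneg h.b2 h.yb2 +
    1 * mul_nonneg h.b2 h.a2 +
    (13/293) * mul_nonneg h.b2 h.yb3 +
    (110/293) * mul_nonneg h.b2 h.g23 +
    (112/293) * mul_nonneg h.b2 h.g24 +
    (224/293) * mul_nonneg h.b2 h.c34 +
    (106/293) * mul_nonneg h.b2 h.r +
    (238/293) * mul_nonneg h.yb2 h.a2 +
    (13/293) * mul_nonneg h.yb2 h.yb3 +
    (42/293) * mul_nonneg h.yb2 h.c12 +
    (15/293) * mul_nonneg h.yb2 h.g24 +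
    (416/879) * mul_nonneg h.yb2 h.c34 +
    (79/879) * mul_nonneg h.yb2 h.r +
    (55/293) * mul_nonneg h.yb2 hy₂ +
    (55/293) * mul_nonneg h.yb2 hG +
    (382/879) * mul_nonneg h.a2 h.c34 +
    (113/879) * mul_nonneg h.a2 h.r +
    (13/293) * mul_nonneg h.a2 hq +
    (280/293) * mul_nonneg h.b3 h.yb3 +
    (724/879) * mul_nonneg h.b3 h.a3 +
    (284/879) * mul_nonneg h.b3 h.c12 +
    (100/879) * mul_nonneg h.b3 h.g23 +
    (192/293) * mul_nonneg h.b3 hG +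
    (685/879) * mul_nonneg h.yb3 h.a3 +
    (61/879) * mul_nonneg h.yb3 h.g23 +
    (13/293) * mul_nonneg h.yb3 h.c34 +
    (13/293) * mul_nonneg h.yb3 hy₃ +
    (400/879) * mul_nonneg h.yb3 hG +
    (43/293) * mul_nonneg h.a3 h.c12 +
    (116/879) * mul_nonneg h.a3 h.g13 +
    (155/879) * mul_nonneg h.a3 hy₄ +
    (176/879) * mul_nonneg h.a3 hG +
    (155/879) * mul_nonneg h.e3 h.g14 +
    1 * mul_nonneg h.b4 h.yb4 +
    (253/293) * mul_nonneg h.b4 h.a4 +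
    (92/879) * mul_nonneg h.b4 h.c12 +
    (136/879) * mul_nonneg h.b4 h.g14 +
    (56/879) * mul_nonneg h.b4 h.g24 +
    (28/879) * mul_nonneg h.b4 h.r +
    (50/879) * mul_nonneg h.b4 hG +
    (253/293) * mul_nonneg h.yb4 h.a4 +
    (64/879) * mul_nonneg h.yb4 h.g13 +
    (256/879) * mul_nonneg h.yb4 h.g14 +
    (28/879) * mul_nonneg h.yb4 h.c34 +
    (28/879) * mul_nonneg h.yb4 hβδ +
    (26/293) * mul_nonneg h.yb4 hG +
    (40/293) * mul_nonneg h.a4 hy₃ +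
    (7/879) * mul_nonneg h.c12 hαβ +
    (136/879) * mul_nonneg h.c12 hy₄ +
    (376/879) * mul_nonneg h.c12 ht +
    (6/293) * mul_nonneg h.g13 hy₂ +
    (344/293) * mul_nonneg h.g13 hy₄ +
    (73/879) * mul_nonneg h.g14 h.c14 +
    (1169/879) * mul_nonneg h.g14 h.g23 +
    (707/879) * mul_nonneg h.g14 hβδ +
    (193/879) * mul_nonneg h.g14 hy₂ +
    (763/879) * mul_nonneg h.g14 hy₃ +
    (2/293) * mul_nonneg h.g14 hr +
    (28/293) * mul_nonneg h.g14 ht +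
    (326/879) * mul_nonneg h.g23 h.c23 +
    (377/879) * mul_nonneg h.g23 hβδ +
    (38/293) * mul_nonneg h.g23 hy₄ +
    (26/293) * mul_nonneg h.c23 hq +
    (8/879) * mul_nonneg h.g24 h.g34 +
    (212/879) * mul_nonneg h.g24 hβδ +
    (658/879) * mul_nonneg h.g24 hr +
    (88/293) * mul_nonneg h.g34 h.c34 +
    (41/879) * mul_nonneg h.dA hG +
    (92/879) * mul_nonneg h.r hy₃ +
    (40/293) * mul_nonneg h.r hy₄ +
    (164/879) * mul_nonneg h.r hq +
    (292/879) * mul_nonneg hαβ hq +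
    (124/879) * mul_nonneg hβδ hy₂ +
    (55/293) * mul_nonneg hβδ hy₃ +
    (101/879) * mul_nonneg hβδ ht +
    (70/879) * mul_nonneg hy₂ hG +
    (32/293) * mul_nonneg hy₄ hq +
    (106/879) * mul_nonneg hG hq +
    (94/879) * mul_nonneg hG ht

lemma ReducedChamber.normSum_le_neg_neg_neg_neg
    (h : ReducedChamber s y₁ y₂ y₃ y₄ b₁ b₂ b₃ b₄ g₁₂ g₁₃ g₁₄ g₂₃ g₂₄ g₃₄)
    (hαβ : 0 ≤ g₁₂ + g₃₄ - g₁₃ - g₂₄)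
    (hβδ : 0 ≤ g₁₃ + g₂₄ - g₁₄ - g₂₃)
    (hy₂ : 0 ≤ y₁ - y₂)
    (hy₃ : 0 ≤ y₁ - y₃)
    (hy₄ : 0 ≤ y₁ - y₄)
    (hG : 0 ≤ g₁₂ + g₁₃ + g₁₄ + g₂₃ + g₂₄ + g₃₄ - s)
    (hp : 0 ≤ -(g₁₃ + g₂₄ - y₃ - y₄ - g₁₂))
    (hq : 0 ≤ -(g₁₂ + g₂₄ + g₃₄ - s))
    (hr : 0 ≤ -(2 * g₂₄ + y₁ + y₃ - s))
    (ht : 0 ≤ -(2 * g₁₂ + y₃ + y₄ - s)) :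
    normSum y₁ y₂ y₃ y₄ b₁ b₂ b₃ b₄ g₁₂ g₁₃ g₁₄ g₂₃ g₂₄ g₃₄ ≤ s ^ 2 := by
  unfold normSum
  linear_combination
    (4246143/4692770) * mul_nonneg h.b1 h.yb1 +
    (446627/4692770) * mul_nonneg h.b1 h.a1 +
    (410929/13139756) * mul_nonneg h.b1 h.a3 +
    (9415197/65698780) * mul_nonneg h.b1 h.a4 +
    (8804301/32849390) * mul_nonneg h.b1 h.g14 +
    (6622097/32849390) * mul_nonneg h.b1 h.c34 +
    (1211764/16424695) * mul_nonneg h.b1 hβδ +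
    (6394557/32849390) * mul_nonneg h.b1 hG +
    (68875/3284939) * mul_nonneg h.yb1 h.yb3 +
    (446627/4692770) * mul_nonneg h.yb1 h.c13 +
    (7186281/65698780) * mul_nonneg h.yb1 h.g24 +
    (3168881/229945730) * mul_nonneg h.a1 h.b2 +
    (19347/1877108) * mul_nonneg h.a1 h.yb3 +
    (9415197/65698780) * mul_nonneg h.a1 h.yb4 +
    (75450209/459891460) * mul_nonneg h.a1 h.g12 +
    (2078119/9385540) * mul_nonneg h.a1 h.g13 +
    (998818/16424695) * mul_nonneg h.a1 h.g14 +
    (6729556/22994573) * mul_nonneg h.a1 h.dA +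
    (1980955/91978292) * mul_nonneg h.a1 hβδ +
    (27638837/229945730) * mul_nonneg h.a1 hy₂ +
    (82543627/459891460) * mul_nonneg h.a1 hy₃ +
    (141821909/459891460) * mul_nonneg h.a1 hy₄ +
    (25558333/229945730) * mul_nonneg h.a1 hG +
    (53778597/459891460) * mul_nonneg h.a1 hp +
    (3168881/229945730) * mul_nonneg h.e1 h.yb2 +
    (403096417/459891460) * mul_nonneg h.b2 h.yb2 +
    (22404881/32849390) * mul_nonneg h.b2 h.a2 +
    (1927/938554) * mul_nonneg h.b2 h.yb4 +
    (586396/2346385) * mul_nonneg h.b2 h.c13 +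
    (7208183/65698780) * mul_nonneg h.b2 h.g24 +
    (30572819/65698780) * mul_nonneg h.b2 h.c34 +
    (1696777/32849390) * mul_nonneg h.b2 h.r +
    (973522/3284939) * mul_nonneg h.b2 hy₂ +
    (256873291/459891460) * mul_nonneg h.yb2 h.a2 +
    (7073293/65698780) * mul_nonneg h.yb2 h.b4 +
    (7208183/65698780) * mul_nonneg h.yb2 h.e4 +
    (70814097/459891460) * mul_nonneg h.yb2 h.c13 +
    (1927/938554) * mul_nonneg h.yb2 h.g14 +
    (1820498/114972865) * mul_nonneg h.yb2 h.c14 +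
    (193447839/919782920) * mul_nonneg h.yb2 h.c34 +
    (3168881/114972865) * mul_nonneg h.yb2 h.dA +
    (8236443/229945730) * mul_nonneg h.yb2 h.r +
    (54998901/229945730) * mul_nonneg h.yb2 hy₂ +
    (5615573/26279512) * mul_nonneg h.a2 h.c34 +
    (28907607/32849390) * mul_nonneg h.b3 h.yb3 +
    (45515171/65698780) * mul_nonneg h.b3 h.a3 +
    (2247046/16424695) * mul_nonneg h.b3 h.c14 +
    (1029121/32849390) * mul_nonneg h.b3 h.r +
    (891321/65698780) * mul_nonneg h.b3 hβδ +
    (84646/3284939) * mul_nonneg h.b3 hy₃ +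
    (8170412/16424695) * mul_nonneg h.b3 hG +
    (6788171/16424695) * mul_nonneg h.b3 hr +
    (228357/32849390) * mul_nonneg h.b3 ht +
    (7526321/13139756) * mul_nonneg h.yb3 h.a3 +
    (3610207/32849390) * mul_nonneg h.yb3 h.g12 +
    (1172023/16424695) * mul_nonneg h.yb3 h.g23 +
    (59914/16424695) * mul_nonneg h.yb3 h.c24 +
    (1953983/18771080) * mul_nonneg h.yb3 h.c34 +
    (301483/2346385) * mul_nonneg h.yb3 hy₃ +
    (6963879/32849390) * mul_nonneg h.yb3 hG +
    (544499/32849390) * mul_nonneg h.yb3 hp +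
    (433567/1877108) * mul_nonneg h.yb3 hr +
    (4632923/65698780) * mul_nonneg h.a3 h.g13 +
    (4260619/65698780) * mul_nonneg h.a3 h.c23 +
    (88323/469277) * mul_nonneg h.a3 h.g34 +
    (8414971/131397560) * mul_nonneg h.a3 h.c34 +
    (955153/6569878) * mul_nonneg h.a3 hG +
    (131333/13139756) * mul_nonneg h.a3 hp +
    (5938339/65698780) * mul_nonneg h.a3 hr +
    (9015797/9385540) * mul_nonneg h.b4 h.yb4 +
    (29849/40306) * mul_nonneg h.b4 h.a4 +
    (9415197/65698780) * mul_nonneg h.b4 h.c13 +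
    (9051289/65698780) * mul_nonneg h.b4 h.c23 +
    (369743/9385540) * mul_nonneg h.b4 h.g24 +
    (180054/2346385) * mul_nonneg h.b4 h.r +
    (46065669/65698780) * mul_nonneg h.yb4 h.a4 +
    (9415197/65698780) * mul_nonneg h.yb4 h.g12 +
    (3417377/65698780) * mul_nonneg h.yb4 h.g14 +
    (9051289/65698780) * mul_nonneg h.yb4 h.c23 +
    (1089959/9385540) * mul_nonneg h.yb4 h.c34 +
    (3409619/65698780) * mul_nonneg h.a4 h.g14 +
    (180054/2346385) * mul_nonneg h.a4 h.g34 +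
    (3480943/32849390) * mul_nonneg h.a4 hy₂ +
    (180054/2346385) * mul_nonneg h.a4 hy₃ +
    (8558901/32849390) * mul_nonneg h.g12 ht +
    (16157139/32849390) * mul_nonneg h.g13 h.g24 +
    (3927401/16424695) * mul_nonneg h.g13 hy₄ +
    (3512895/13139756) * mul_nonneg h.c13 hβδ +
    (6361651/32849390) * mul_nonneg h.g14 h.c14 +
    (5806339/4692770) * mul_nonneg h.g14 h.g23 +
    (19841587/32849390) * mul_nonneg h.g14 hβδ +
    (6948336/16424695) * mul_nonneg h.g14 hy₂ +
    (5589623/16424695) * mul_nonneg h.g14 hy₃ +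
    (458131/9385540) * mul_nonneg h.g14 hp +
    (1712062/3284939) * mul_nonneg h.g23 h.c23 +
    (26166629/65698780) * mul_nonneg h.g23 hβδ +
    (720876/16424695) * mul_nonneg h.c23 hq +
    (3597033/32849390) * mul_nonneg h.g24 hβδ +
    (2753297/32849390) * mul_nonneg h.g24 hq +
    (31260127/65698780) * mul_nonneg h.g24 hr +
    (4903781/18771080) * mul_nonneg h.c34 hαβ +
    (1698661/9385540) * mul_nonneg h.c34 hβδ +
    (1432057/6569878) * mul_nonneg h.c34 hy₄ +
    (9452761/32849390) * mul_nonneg h.c34 hp +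
    (1887773/4692770) * mul_nonneg h.c34 ht +
    (1498291/65698780) * mul_nonneg h.r hp +
    (5690287/32849390) * mul_nonneg h.r hq +
    (1426563/4692770) * mul_nonneg hαβ hq +
    (774777/16424695) * mul_nonneg hβδ hy₄ +
    (1445879/32849390) * mul_nonneg hy₂ hG +
    (81637/469277) * mul_nonneg hy₄ hr +
    (679464/2346385) * mul_nonneg hG hp +
    (1453222/16424695) * mul_nonneg hG hq +
    (9083531/65698780) * mul_nonneg hp ht

lemma ReducedChamber.normSum_le_of_sum_le
    (h : ReducedChamber s y₁ y₂ y₃ y₄ b₁ b₂ b₃ b₄ g₁₂ g₁₃ g₁₄ g₂₃ g₂₄ g₃₄)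
    (hG : 0 ≤ s - (g₁₂ + g₁₃ + g₁₄ + g₂₃ + g₂₄ + g₃₄)) :
    normSum y₁ y₂ y₃ y₄ b₁ b₂ b₃ b₄ g₁₂ g₁₃ g₁₄ g₂₃ g₂₄ g₃₄ ≤ s ^ 2 := by
  unfold normSum
  linear_combination mul_nonneg hG h.r +
    mul_nonneg h.g12 h.c12 + mul_nonneg h.g13 h.c13 + mul_nonneg h.g14 h.c14 +
    mul_nonneg h.g23 h.c23 + mul_nonneg h.g24 h.c24 + mul_nonneg h.g34 h.c34 +
    mul_nonneg (add_nonneg h.b1 h.yb1) h.a1 + mul_nonneg (add_nonneg h.b2 h.yb2) h.a2 +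
    mul_nonneg (add_nonneg h.b3 h.yb3) h.a3 + mul_nonneg (add_nonneg h.b4 h.yb4) h.a4 +
    mul_nonneg h.b1 h.yb1 + mul_nonneg h.b2 h.yb2 + mul_nonneg h.b3 h.yb3 +
    mul_nonneg h.b4 h.yb4

/-- The quadratic form is nonnegative on the reduced chamber. The case tree and the
certificates on its leaves were found by linear programming. -/
lemma ReducedChamber.normSum_le
    (h : ReducedChamber s y₁ y₂ y₃ y₄ b₁ b₂ b₃ b₄ g₁₂ g₁₃ g₁₄ g₂₃ g₂₄ g₃₄)
    (hαβ : 0 ≤ g₁₂ + g₃₄ - g₁₃ - g₂₄)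
    (hβδ : 0 ≤ g₁₃ + g₂₄ - g₁₄ - g₂₃)
    (hy₂ : 0 ≤ y₁ - y₂)
    (hy₃ : 0 ≤ y₁ - y₃)
    (hy₄ : 0 ≤ y₁ - y₄) :
    normSum y₁ y₂ y₃ y₄ b₁ b₂ b₃ b₄ g₁₂ g₁₃ g₁₄ g₂₃ g₂₄ g₃₄ ≤ s ^ 2 := by
  have split : ∀ t : ℚ, 0 ≤ t ∨ 0 ≤ -t := fun t => (le_total 0 t).imp_right neg_nonneg.2
  rcases le_total s (g₁₂ + g₁₃ + g₁₄ + g₂₃ + g₂₄ + g₃₄) with hG | hG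
  swap
  · exact h.normSum_le_of_sum_le (sub_nonneg.2 hG)
  rw [← sub_nonneg] at hG
  rcases split (g₁₃ + g₂₄ - y₃ - y₄ - g₁₂) with hp | hp
  · rcases split (s + g₁₃ - y₁ - b₁ - g₂₃ - g₃₄) with hq | hq
    · rcases split (y₁ + y₄ - y₂ - b₂ - g₁₂ - g₂₄) with hr | hr
      · exact h.normSum_le_pos_pos_pos hαβ hβδ hy₂ hy₃ hy₄ hG hp hq hr
      · exact h.normSum_le_pos_pos_neg hαβ hβδ hy₂ hy₃ hy₄ hG hp hq hr
    · rcases split (2 * b₁ + y₁ + g₂₃ + g₂₄ + g₃₄ - 2 * s) with hr | hr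
      · exact h.normSum_le_pos_neg_pos hαβ hβδ hy₂ hy₄ hG hp hr
      · exact h.normSum_le_pos_neg_neg hαβ hβδ hy₂ hy₃ hy₄ hG hp hq hr
  · rcases split (g₁₂ + g₂₄ + g₃₄ - s) with hq | hq
    · rcases split (y₁ + g₂₃ - y₃ - g₁₂) with hr | hr
      · rcases split (b₁ - y₄) with ht | ht
        · exact h.normSum_le_neg_pos_pos_pos hαβ hβδ hy₂ hy₃ hy₄ hG hp hq hr ht
        · exact h.normSum_le_neg_pos_pos_neg hαβ hβδ hy₂ hy₃ hy₄ hp hq hr ht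
      · rcases split (y₁ + g₂₄ - y₄ - g₁₂) with ht | ht
        · exact h.normSum_le_neg_pos_neg_pos hy₃ hp hq hr ht
        · exact h.normSum_le_neg_pos_neg_neg hβδ hy₃ hy₄ hG hp hq hr ht
    · rcases split (2 * g₂₄ + y₁ + y₃ - s) with hr | hr
      · rcases split (s + y₃ + y₄ + g₁₂ - y₁ - b₁ - g₂₃ - g₂₄ - g₃₄) with ht | ht
        · exact h.normSum_le_neg_neg_pos_pos hαβ hβδ hy₂ hy₃ hy₄ hG hp hq hr ht
        · exact h.normSum_le_neg_neg_pos_neg hαβ hβδ hy₂ hy₃ hy₄ hG hp hq hr ht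
      · rcases split (2 * g₁₂ + y₃ + y₄ - s) with ht | ht
        · exact h.normSum_le_neg_neg_neg_pos hαβ hβδ hy₂ hy₃ hy₄ hG hq hr ht
        · exact h.normSum_le_neg_neg_neg_neg hαβ hβδ hy₂ hy₃ hy₄ hG hp hq hr ht

end ReducedChamber

section Chamber

/-- The chamber of `W_r` in coordinates: `B` are the products with the edge roots and `D`
the dual coordinates of the vertex roots. -/
structure IsChamberPoint (D : Fin 5 → ℚ) (B : Fin 5 → Fin 5 → ℚ) : Prop where
  symm : ∀ i j, B i j = B j i
  diag : ∀ i, B i i = 0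
  edge : ∀ i j, 0 ≤ B i j
  vertex : ∀ i, ∑ j, B i j ≤ D i
  pair : ∀ i j, i ≠ j → 2 * (B i j + D i + D j) ≤ ∑ n, D n
  matching : ∀ i j k l m, [i, j, k, l, m].Nodup → 2 * (B j k + B l m + D i) ≤ ∑ n, D n
  triangle : ∀ i j k l m, [i, j, k, l, m].Nodup →
    2 * (B i j + B k l + B k m + B l m + D i - D j) ≤ ∑ n, D n

variable {i j k l m : Fin 5} {D : Fin 5 → ℚ} {B : Fin 5 → Fin 5 → ℚ}

lemma sum_eq_of_nodup {M : Type*} [AddCommMonoid M] (hn : [i, j, k, l, m].Nodup)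
    (f : Fin 5 → M) :
    ∑ n, f n = f i + f j + f k + f l + f m := by
  have hu : [i, j, k, l, m].toFinset = Finset.univ := by
    rw [← Finset.card_eq_iff_eq_univ, List.toFinset_card_of_nodup hn]; rfl
  rw [← hu, List.sum_toFinset f hn]
  simp [add_assoc]

lemma exists_matching_order (hsymm : ∀ i j, B i j = B j i) (hn : [i, j, k, l, m].Nodup) :
    ∃ j k l m, [i, j, k, l, m].Nodup ∧ B j l + B k m ≤ B j k + B l m ∧
      B j m + B k l ≤ B j l + B k m := by
  have h₁ := hsymm l k
  have h₂ := hsymm m k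
  have h₃ := hsymm m l
  have hp : ∀ {j' k' l' m'}, [j', k', l', m'].Perm [j, k, l, m] → [i, j', k', l', m'].Nodup :=
    fun h => (h.cons i).nodup_iff.2 hn
  rcases le_total (B j l + B k m) (B j k + B l m) with h | h <;>
  rcases le_total (B j m + B k l) (B j l + B k m) with h' | h' <;>
  rcases le_total (B j m + B k l) (B j k + B l m) with h'' | h''
  · exact ⟨j, k, l, m, hn, h, h'⟩
  · exact ⟨j, k, l, m, hn, h, h'⟩
  · exact ⟨j, k, m, l, hp (by grind), by linarith, by linarith⟩
  · exact ⟨j, m, k, l, hp (by grind), by linarith, by linarith⟩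
  · exact ⟨j, l, k, m, hp (by grind), by linarith, by linarith⟩
  · exact ⟨j, l, m, k, hp (by grind), by linarith, by linarith⟩
  · exact ⟨j, m, l, k, hp (by grind), by linarith, by linarith⟩
  · exact ⟨j, m, l, k, hp (by grind), by linarith, by linarith⟩

lemma exists_arrangement (hsymm : ∀ i j, B i j = B j i) (D : Fin 5 → ℚ) (i : Fin 5) :
    ∃ j k l m, [i, j, k, l, m].Nodup ∧ B j l + B k m ≤ B j k + B l m ∧
      B j m + B k l ≤ B j l + B k m ∧ D j ≤ D k ∧ D j ≤ D l ∧ D j ≤ D m := by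
  obtain ⟨j, k, l, m, hn⟩ : ∃ j k l m, [i, j, k, l, m].Nodup := by
    revert i; decide
  obtain ⟨j, k, l, m, hn, h, h'⟩ := exists_matching_order hsymm hn
  have hp : ∀ {j' k' l' m'}, [j', k', l', m'].Perm [j, k, l, m] → [i, j', k', l', m'].Nodup :=
    fun h => (h.cons i).nodup_iff.2 hn
  have e₁ := hsymm k j
  have e₂ := hsymm l j
  have e₃ := hsymm m j
  have e₄ := hsymm l k
  have e₅ := hsymm m k
  have e₆ := hsymm m l
  by_cases hj : D j ≤ D k ∧ D j ≤ D l ∧ D j ≤ D m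
  · exact ⟨j, k, l, m, hn, h, h', hj⟩
  by_cases hk : D k ≤ D j ∧ D k ≤ D l ∧ D k ≤ D m
  · exact ⟨k, j, m, l, hp (by grind), by linarith, by linarith, by grind⟩
  by_cases hl : D l ≤ D j ∧ D l ≤ D k ∧ D l ≤ D m
  · exact ⟨l, m, j, k, hp (by grind), by linarith, by linarith, by grind⟩
  · exact ⟨m, l, k, j, hp (by grind), by linarith, by linarith, by grind⟩

namespace IsChamberPoint

lemma sq_le_of_forall_le (h : IsChamberPoint D B) (hD : ∀ i, 4 * D i ≤ ∑ n, D n) :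
    4 * ∑ i, D i ^ 2 + 2 * ∑ i, ∑ j, B i j ^ 2 ≤ (∑ i, D i) ^ 2 := by
  have he : 0 ≤ ∑ i, ∑ j, B i j * (∑ n, D n - 2 * (B i j + D i + D j)) := by
    refine Finset.sum_nonneg fun i _ => Finset.sum_nonneg fun j _ => ?_
    rcases eq_or_ne i j with rfl | hij
    · simp [h.diag]
    · exact mul_nonneg (h.edge i j) (sub_nonneg.2 (h.pair i j hij))
  have hv : 0 ≤ ∑ i, (D i - ∑ j, B i j) * (∑ n, D n - 4 * D i) :=
    Finset.sum_nonneg fun i _ => mul_nonneg (sub_nonneg.2 (h.vertex i)) (sub_nonneg.2 (hD i))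
  simp only [Fin.sum_univ_five, h.diag, h.symm 1 0, h.symm 2 0, h.symm 3 0, h.symm 4 0,
    h.symm 2 1, h.symm 3 1, h.symm 4 1, h.symm 3 2, h.symm 4 2, h.symm 4 3] at he hv ⊢
  linear_combination he + hv

lemma sq_le_of_le (h : IsChamberPoint D B) (hi : ∑ n, D n ≤ 4 * D i) :
    4 * ∑ i, D i ^ 2 + 2 * ∑ i, ∑ j, B i j ^ 2 ≤ (∑ i, D i) ^ 2 := by
  obtain ⟨j, k, l, m, hn, h₁, h₂, hk, hl, hm⟩ := exists_arrangement h.symm D i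
  have hp : ∀ {i' j' k' l' m'}, [i', j', k', l', m'].Perm [i, j, k, l, m] →
      [i', j', k', l', m'].Nodup := fun h => h.nodup_iff.2 hn
  have hne := hn
  simp only [List.nodup_cons, List.mem_cons, not_or, List.not_mem_nil, not_false_eq_true,
    List.nodup_nil, and_true] at hne
  obtain ⟨⟨hij, hik, hil, him⟩, ⟨hjk, hjl, hjm⟩, ⟨hkl, hkm⟩, hlm⟩ := hne
  have hT := sum_eq_of_nodup hn D
  have hV := fun n => (sum_eq_of_nodup hn (B n)) ▸ h.vertex n
  have vj := hV j
  have vk := hV k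
  have vl := hV l
  have vm := hV m
  have hP := h.pair
  have hM := h.matching
  have hE := h.triangle
  have hR : ReducedChamber ((∑ n, D n) / 2 - D i) ((∑ n, D n) / 2 - D i - D j)
      ((∑ n, D n) / 2 - D i - D k) ((∑ n, D n) / 2 - D i - D l) ((∑ n, D n) / 2 - D i - D m)
      (B i j) (B i k) (B i l) (B i m) (B j k) (B j l) (B j m) (B k l) (B k m) (B l m) := by
    simp only [h.symm j i, h.symm k i, h.symm l i, h.symm m i, h.symm k j, h.symm l j,
      h.symm m j, h.symm l k, h.symm m k, h.symm m l, h.diag] at vj vk vl vm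
    constructor
    · exact h.edge i j
    · linarith [hP i j hij]
    · linarith
    · linarith [hE i j k l m hn]
    · exact h.edge i k
    · linarith [hP i k hik]
    · linarith
    · linarith [hE i k j l m (hp (by grind))]
    · exact h.edge i l
    · linarith [hP i l hil]
    · linarith
    · linarith [hE i l j k m (hp (by grind))]
    · exact h.edge i m
    · linarith [hP i m him]
    · linarith
    · linarith [hE i m j k l (hp (by grind))]
    · exact h.edge j k
    · linarith [hP j k hjk]
    · exact h.edge j l
    · linarith [hP j l hjl]
    · exact h.edge j m
    · linarith [hP j m hjm]
    · exact h.edge k l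
    · linarith [hP k l hkl]
    · exact h.edge k m
    · linarith [hP k m hkm]
    · exact h.edge l m
    · linarith [hP l m hlm]
    · linarith [hM i j k l m hn]
    · linarith [hM i j l k m (hp (by grind))]
    · linarith [hM i j m k l (hp (by grind))]
    · linarith
  have key := hR.normSum_le (by linarith) (by linarith) (by linarith) (by linarith) (by linarith)
  unfold normSum at key
  simp only [sum_eq_of_nodup hn, h.symm j i, h.symm k i, h.symm l i, h.symm m i, h.symm k j,
    h.symm l j, h.symm m j, h.symm l k, h.symm m k, h.symm m l, h.diag] at key ⊢
  linear_combination 4 * key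

theorem sq_le (h : IsChamberPoint D B) :
    4 * ∑ i, D i ^ 2 + 2 * ∑ i, ∑ j, B i j ^ 2 ≤ (∑ i, D i) ^ 2 := by
  by_cases hD : ∀ i, 4 * D i ≤ ∑ n, D n
  · exact h.sq_le_of_forall_le hD
  · push Not at hD
    obtain ⟨i, hi⟩ := hD
    exact h.sq_le_of_le hi.le

end IsChamberPoint

end Chamber

section Coordinates

/-- Twice the product of `x` with a vertex root, plus its products with the edges there. -/
def dualCoord (x : Fin 15 → ℤ) (i : Fin 5) : ℤ :=
  2 * bform gramS x (vertexRoot i) + ∑ j, bform gramS x (edgeRoot i j)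

lemma bform_interiorVector_vertexRoot (i : Fin 5) :
    bform gramS (vertexRoot i) interiorVector = 2 := by
  rw [bform_gramS]
  revert i
  decide +kernel

lemma bform_interiorVector_edgeRoot {i j : Fin 5} (hij : i ≠ j) :
    bform gramS (edgeRoot i j) interiorVector = 2 := by
  rw [bform_gramS]
  revert i j
  decide +kernel

lemma bform_chamberRoot_interiorVector_pos (t : Fin 5 × Equiv.Perm (Fin 5)) :
    0 < bform gramS (chamberRoot t) interiorVector := by
  obtain ⟨k, σ⟩ := t
  have hb : ∀ {i j : Fin 5}, i ≠ j →
      bform gramS (edgeRoot (σ i) (σ j)) interiorVector = 2 := fun hij =>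
    bform_interiorVector_edgeRoot (σ.injective.ne hij)
  fin_cases k <;>
  simp [-zsmul_eq_mul, -smul_eq_mul, chamberRoot, bform_add_left, bform_sub_left,
    bform_neg_left, bform_smul_left, bform_interiorVector_vertexRoot, hb]

lemma edgeRoot_comm (i j : Fin 5) : edgeRoot i j = edgeRoot j i := by
  revert i j
  decide +kernel

lemma edgeRoot_self (i : Fin 5) : edgeRoot i i = 0 := by
  revert i
  decide +kernel

variable (x : Fin 15 → ℤ)

lemma eight_mul_bform_self :
    8 * bform gramS x x = (∑ i, dualCoord x i) ^ 2 - 4 * ∑ i, dualCoord x i ^ 2 -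
      2 * ∑ i, ∑ j, bform gramS x (edgeRoot i j) ^ 2 := by
  simp [dualCoord, bform_gramS, vertexRoot, edgeRoot, Fin.sum_univ_five]
  ring

lemma bform_interiorVector :
    bform gramS x interiorVector = 3 * ∑ i, bform gramS x (vertexRoot i) +
      ∑ i, ∑ j, bform gramS x (edgeRoot i j) := by
  simp [bform_gramS, vertexRoot, edgeRoot, interiorVector, Fin.sum_univ_five]
  ring

lemma three_mul_sum_dualCoord :
    3 * ∑ i, dualCoord x i = 2 * bform gramS x interiorVector +
      ∑ i, ∑ j, bform gramS x (edgeRoot i j) := by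
  simp only [bform_interiorVector, dualCoord, Finset.sum_add_distrib, ← Finset.mul_sum]
  ring

variable {x}

lemma eq_zero_of_bform_roots_eq_zero (hA : ∀ i, bform gramS x (vertexRoot i) = 0)
    (hB : ∀ i j, bform gramS x (edgeRoot i j) = 0) : x = 0 := by
  simp only [Fin.forall_fin_succ, bform_gramS, vertexRoot, edgeRoot] at hA hB
  simp at hA hB
  obtain ⟨a₀, a₁, a₂, a₃, a₄⟩ := hA
  obtain ⟨⟨b₀₁, b₀₂, -, -⟩, ⟨-, b₁₂, -, -⟩, -, ⟨b₃₀, b₃₁, b₃₂, b₃₄⟩, b₄₀, b₄₁, b₄₂, -⟩ := hB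
  have h14 : x 14 = 0 := by linarith
  have h1 : x 1 = 0 := by linarith
  have h5 : x 5 = 0 := by linarith
  have h9 : x 9 = 0 := by linarith
  have h13 : x 13 = 0 := by linarith
  ext i
  fin_cases i <;> simp <;> linarith

lemma bform_self_le : 240 * bform gramS x x ≤ 8 * bform gramS x interiorVector ^ 2 -
    15 * ∑ i, dualCoord x i ^ 2 - 10 * ∑ i, ∑ j, bform gramS x (edgeRoot i j) ^ 2 := by
  have h₁ := eight_mul_bform_self x
  have h₂ := three_mul_sum_dualCoord x
  have h₃ : (∑ i, dualCoord x i) ^ 2 ≤ 5 * ∑ i, dualCoord x i ^ 2 := by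
    simpa using sq_sum_le_card_mul_sum_sq (s := Finset.univ) (f := dualCoord x)
  have h₄ : (∑ p : Fin 5 × Fin 5, bform gramS x (edgeRoot p.1 p.2)) ^ 2 ≤
      25 * ∑ p : Fin 5 × Fin 5, bform gramS x (edgeRoot p.1 p.2) ^ 2 := by
    simpa using sq_sum_le_card_mul_sum_sq (s := (Finset.univ : Finset (Fin 5 × Fin 5)))
      (f := fun p => bform gramS x (edgeRoot p.1 p.2))
  simp only [Fintype.sum_prod_type] at h₄
  linear_combination 30 * h₁ + 21 * h₃ + 2 * h₄ +
    sq_nonneg (2 * bform gramS x interiorVector - ∑ i, ∑ j, bform gramS x (edgeRoot i j)) +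
    (3 * ∑ i, dualCoord x i + 2 * bform gramS x interiorVector +
      ∑ i, ∑ j, bform gramS x (edgeRoot i j)) * h₂

lemma bform_self_nonpos (h : bform gramS x interiorVector = 0) : bform gramS x x ≤ 0 := by
  have key := bform_self_le (x := x)
  rw [h] at key
  have h₁ : 0 ≤ ∑ i, dualCoord x i ^ 2 := Finset.sum_nonneg fun i _ => sq_nonneg _
  have h₂ : 0 ≤ ∑ i, ∑ j, bform gramS x (edgeRoot i j) ^ 2 :=
    Finset.sum_nonneg fun i _ => Finset.sum_nonneg fun j _ => sq_nonneg _
  linarith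

lemma coordinates_injective : Function.Injective fun x : Fin 15 → ℤ =>
    (dualCoord x, fun i j => bform gramS x (edgeRoot i j)) := by
  intro x y hxy
  obtain ⟨hD, hB⟩ := Prod.mk.inj hxy
  have hB' := fun i j => congrFun (congrFun hB i) j
  rw [← sub_eq_zero]
  refine eq_zero_of_bform_roots_eq_zero (fun i => ?_) fun i j => ?_
  · have hi := congrFun hD i
    simp only [dualCoord, hB'] at hi
    rw [bform_sub_left]
    linarith
  · rw [bform_sub_left, hB', sub_self]

lemma finite_setOf_bform_eq (a b : ℤ) :
    {x | bform gramS x interiorVector = a ∧ bform gramS x x = b}.Finite := by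
  set c := 8 * a ^ 2 - 240 * b
  classical
  refine (((Set.finite_Icc (fun _ => -c) fun _ => c).prod
    (Set.finite_Icc (fun _ _ => -c) fun _ _ => c)).preimage
    coordinates_injective.injOn).subset ?_
  rintro x ⟨ha, hb⟩
  have key := bform_self_le (x := x)
  rw [ha, hb] at key
  have abs_le_of_sq : ∀ t : ℤ, t ^ 2 ≤ c → -c ≤ t ∧ t ≤ c := fun t ht =>
    abs_le.1 ((Int.natCast_natAbs t ▸ Int.natAbs_le_self_sq t).trans ht)
  have h₁ : 0 ≤ ∑ i, dualCoord x i ^ 2 := Finset.sum_nonneg fun i _ => sq_nonneg _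
  have h₂ : ∀ i, 0 ≤ ∑ j, bform gramS x (edgeRoot i j) ^ 2 :=
    fun i => Finset.sum_nonneg fun j _ => sq_nonneg _
  have h₃ : 0 ≤ ∑ i, ∑ j, bform gramS x (edgeRoot i j) ^ 2 := Finset.sum_nonneg fun i _ => h₂ i
  have hD : ∀ i, dualCoord x i ^ 2 ≤ c := fun i => by
    have := Finset.single_le_sum (fun i _ => sq_nonneg (dualCoord x i)) (Finset.mem_univ i)
    linarith
  have hB : ∀ i j, bform gramS x (edgeRoot i j) ^ 2 ≤ c := fun i j => by
    have h₄ := Finset.single_le_sum (fun j _ => sq_nonneg (bform gramS x (edgeRoot i j)))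
      (Finset.mem_univ j)
    have h₅ := Finset.single_le_sum (fun i _ => h₂ i) (Finset.mem_univ i)
    linarith
  exact ⟨⟨fun i => (abs_le_of_sq _ (hD i)).1, fun i => (abs_le_of_sq _ (hD i)).2⟩,
    fun i j => (abs_le_of_sq _ (hB i j)).1, fun i j => (abs_le_of_sq _ (hB i j)).2⟩

lemma exists_perm_of_nodup {i j k l m : Fin 5} (hn : [i, j, k, l, m].Nodup) :
    ∃ σ : Equiv.Perm (Fin 5), σ 0 = i ∧ σ 1 = j ∧ σ 2 = k ∧ σ 3 = l ∧ σ 4 = m := by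
  have hinj : Function.Injective ![i, j, k, l, m] := by
    rw [← List.nodup_ofFn]
    simpa [List.ofFn_succ] using hn
  exact ⟨Equiv.ofBijective _ (Finite.injective_iff_bijective.1 hinj), rfl, rfl, rfl, rfl, rfl⟩

lemma exists_nodup_of_ne {i j : Fin 5} (hij : i ≠ j) : ∃ k l m, [i, j, k, l, m].Nodup := by
  revert i j
  decide

lemma isChamberPoint_of_nonneg (hx : ∀ t, 0 ≤ bform gramS x (chamberRoot t)) :
    IsChamberPoint (fun i => (dualCoord x i : ℚ))
      fun i j => (bform gramS x (edgeRoot i j) : ℚ) := by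
  have hvertex : ∀ i, 0 ≤ bform gramS x (vertexRoot i) := fun i => by
    simpa [chamberRoot] using hx (0, Equiv.swap 0 i)
  have hsymm : ∀ i j, bform gramS x (edgeRoot i j) = bform gramS x (edgeRoot j i) :=
    fun i j => by rw [edgeRoot_comm]
  have hdiag : ∀ i, bform gramS x (edgeRoot i i) = 0 := fun i => by
    simp [edgeRoot_self, bform]
  have hfacet : ∀ {i j k l m : Fin 5} (hn : [i, j, k, l, m].Nodup),
      2 * (bform gramS x (edgeRoot i j) + dualCoord x i + dualCoord x j) ≤ ∑ n, dualCoord x n ∧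
      2 * (bform gramS x (edgeRoot j k) + bform gramS x (edgeRoot l m) + dualCoord x i) ≤
        ∑ n, dualCoord x n ∧
      2 * (bform gramS x (edgeRoot i j) + bform gramS x (edgeRoot k l) +
        bform gramS x (edgeRoot k m) + bform gramS x (edgeRoot l m) + dualCoord x i -
        dualCoord x j) ≤ ∑ n, dualCoord x n := by
    intro i j k l m hn
    obtain ⟨σ, h₀, h₁, h₂, h₃, h₄⟩ := exists_perm_of_nodup hn
    have hpair := hx (2, σ)
    have hmatching := hx (3, σ)
    have htriangle := hx (4, σ)
    simp only [chamberRoot, Matrix.cons_val, bform_add_right, bform_sub_right, bform_neg_right,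
      bform_smul_right, h₀, h₁, h₂, h₃, h₄] at hpair hmatching htriangle
    rw [sum_eq_of_nodup hn]
    simp only [dualCoord, sum_eq_of_nodup hn, hdiag, hsymm j i, hsymm k i, hsymm l i, hsymm m i,
      hsymm k j, hsymm l j, hsymm m j, hsymm l k, hsymm m k, hsymm m l]
    refine ⟨?_, ?_, ?_⟩ <;> linarith
  refine ⟨fun i j => by rw [hsymm], fun i => by simp [hdiag], fun i j => ?_, fun i => ?_,
    fun i j hij => ?_, fun _ _ _ _ _ hn => ?_, fun _ _ _ _ _ hn => ?_⟩
  · rcases eq_or_ne i j with rfl | hij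
    · simp [hdiag]
    · obtain ⟨k, l, m, hn⟩ := exists_nodup_of_ne hij
      obtain ⟨σ, h₀, h₁, -⟩ := exists_perm_of_nodup hn
      have := hx (1, σ)
      simp only [chamberRoot, Matrix.cons_val, h₀, h₁] at this
      exact_mod_cast this
  · have := hvertex i
    have : ∑ j, bform gramS x (edgeRoot i j) ≤ dualCoord x i := by
      rw [dualCoord]; linarith
    exact_mod_cast this
  · obtain ⟨k, l, m, hn⟩ := exists_nodup_of_ne hij
    exact_mod_cast (hfacet hn).1
  · exact_mod_cast (hfacet hn).2.1
  · exact_mod_cast (hfacet hn).2.2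

lemma nonneg_and_pos_of_nonneg (hx₀ : x ≠ 0) (hx : ∀ t, 0 ≤ bform gramS x (chamberRoot t)) :
    0 ≤ bform gramS x x ∧ 0 < bform gramS x interiorVector := by
  have hc := isChamberPoint_of_nonneg hx
  have hA : ∀ i, 0 ≤ bform gramS x (vertexRoot i) := fun i => by
    simpa [chamberRoot] using hx (0, Equiv.swap 0 i)
  have hB : ∀ i j, 0 ≤ bform gramS x (edgeRoot i j) := fun i j => by
    exact_mod_cast hc.edge i j
  constructor
  · have h₁ : 4 * ∑ i, dualCoord x i ^ 2 + 2 * ∑ i, ∑ j, bform gramS x (edgeRoot i j) ^ 2 ≤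
        (∑ i, dualCoord x i) ^ 2 := by
      exact_mod_cast hc.sq_le
    linarith [eight_mul_bform_self x]
  · have hh := bform_interiorVector x
    have hsA : 0 ≤ ∑ i, bform gramS x (vertexRoot i) := Finset.sum_nonneg fun i _ => hA i
    have hsB' : ∀ i, 0 ≤ ∑ j, bform gramS x (edgeRoot i j) :=
      fun i => Finset.sum_nonneg fun j _ => hB i j
    have hsB : 0 ≤ ∑ i, ∑ j, bform gramS x (edgeRoot i j) := Finset.sum_nonneg fun i _ => hsB' i
    by_contra hle
    refine hx₀ (eq_zero_of_bform_roots_eq_zero (fun i => le_antisymm ?_ (hA i))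
      fun i j => le_antisymm ?_ (hB i j))
    · have := Finset.single_le_sum (fun i _ => hA i) (Finset.mem_univ i)
      linarith
    · have h₁ := Finset.single_le_sum (fun j _ => hB i j) (Finset.mem_univ j)
      have h₂ := Finset.single_le_sum (fun i _ => hsB' i) (Finset.mem_univ i)
      linarith

end Coordinates

/-- The lattice `U ⊕ D₄ ⊕ D₄ ⊕ D₄ ⊕ A₁` is reflective: the subgroup `W_r` of `O(S)`
generated by the reflections in all roots has finite index in `O(S)`. -/
theorem reflective_15_7_1 : (Wr _ gramS).FiniteIndex :=
  finiteIndex_Wr_of_cone isSymm_gramS isRoot_chamberRoot bform_chamberRoot_interiorVector_pos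
    (by rw [bform_gramS]; decide) (fun _ => bform_self_nonpos) finite_setOf_bform_eq
    fun _ => nonneg_and_pos_of_nonneg
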